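/- Let m, n be positive integers with m/n ≤ 1/2 and n ≠ m + 2. Let ‖·‖₁ be any norm on ℝⁿ and ‖·‖₂ any norm on ℝᵐ. Then there exists c_{m,n} = c_{m,n}(‖·‖₁,‖·‖₂) > 0 such that for every c ∈ [0, c_{m,n}]: dim_H FS_{m,n}(‖·‖₁,‖·‖₂,c) ≥ (n−2)m. The same dimension bound holds when one additionally restricts to matrices Ω that (i) have full ℝ-rank m (rows linearly independent over ℝ) and (ii) whose entries together with 1 form a set linearly independent over ℚ. In particular the Dirichlet spectrum contains some right neighborhood of 0. -/

import Mathlib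

open Filter MeasureTheory
open scoped ENNReal

/-- `N` is a norm on `ℝ^k` (viewed as `Fin k → ℝ`). -/
def IsNorm {k : ℕ} (N : (Fin k → ℝ) → ℝ) : Prop :=
  (∀ x, N x = 0 ↔ x = 0) ∧ (∀ (c : ℝ) (x : Fin k → ℝ), N (c • x) = |c| * N x) ∧
    ∀ x y, N (x + y) ≤ N x + N y

/-- The best approximation function `ψ_Ω(‖·‖₁,‖·‖₂,t)` of an `m × n` matrix `Ω`. -/
noncomputable def psiGen (m n : ℕ) (N1 : (Fin n → ℝ) → ℝ) (N2 : (Fin m → ℝ) → ℝ)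
    (Ω : Fin m → Fin n → ℝ) (t : ℝ) : ℝ :=
  sInf { r : ℝ | ∃ (bh : Fin n → ℤ) (bt : Fin m → ℤ),
    1 ≤ N1 (fun i => (bh i : ℝ)) ∧ N1 (fun i => (bh i : ℝ)) ≤ t ∧
    r = N2 (fun j => (∑ i, Ω j i * (bh i : ℝ)) + (bt j : ℝ)) }

/-- `Θ(Ω) = limsup_{t→∞} t^{n/m} ψ_Ω(t)`. -/
noncomputable def ThetaGen (m n : ℕ) (N1 : (Fin n → ℝ) → ℝ) (N2 : (Fin m → ℝ) → ℝ)
    (Ω : Fin m → Fin n → ℝ) : ℝ :=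
  limsup (fun t : ℝ => t ^ ((n : ℝ) / (m : ℝ)) * psiGen m n N1 N2 Ω t) atTop

/-- `Θ̃(Ω) = liminf_{t→∞} t^{n/m} ψ_Ω(t)`. -/
noncomputable def ThetaTildeGen (m n : ℕ) (N1 : (Fin n → ℝ) → ℝ) (N2 : (Fin m → ℝ) → ℝ)
    (Ω : Fin m → Fin n → ℝ) : ℝ :=
  liminf (fun t : ℝ => t ^ ((n : ℝ) / (m : ℝ)) * psiGen m n N1 N2 Ω t) atTop

/-- `FS_{m,n}(‖·‖₁,‖·‖₂,c) = DI_{m,n}(‖·‖₁,‖·‖₂,c) \ Bad_{m,n}`. -/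
def FSsetC (m n : ℕ) (N1 : (Fin n → ℝ) → ℝ) (N2 : (Fin m → ℝ) → ℝ) (c : ℝ) :
    Set (Fin m → Fin n → ℝ) :=
  {Ω | ThetaGen m n N1 N2 Ω = c} \ {Ω | 0 < ThetaTildeGen m n N1 N2 Ω}

/-- The entries of `Ω`, together with `1`, form a `ℚ`-linearly independent family. -/
def QIndepEntries (m n : ℕ) (Ω : Fin m → Fin n → ℝ) : Prop :=
  LinearIndependent ℚ
    (fun o : Option (Fin m × Fin n) => o.elim (1 : ℝ) (fun p => Ω p.1 p.2))

namespace IsNorm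

variable {k : ℕ} {N : (Fin k → ℝ) → ℝ}

lemma map_zero (h : IsNorm N) : N 0 = 0 := (h.1 0).2 rfl

lemma map_neg (h : IsNorm N) (x : Fin k → ℝ) : N (-x) = N x := by
  have := h.2.1 (-1) x
  simpa using this

lemma nonneg (h : IsNorm N) (x : Fin k → ℝ) : 0 ≤ N x := by
  have h1 := h.2.2 x (-x)
  rw [add_neg_cancel, h.map_zero, h.map_neg] at h1
  linarith

lemma abs_sub_le (h : IsNorm N) (x y : Fin k → ℝ) : |N x - N y| ≤ N (x - y) := by
  have h1 := h.2.2 (x - y) y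
  have h2 := h.2.2 (y - x) x
  rw [← neg_sub x y, h.map_neg] at h2
  simp only [sub_add_cancel, neg_sub] at h1 h2
  rw [abs_le]
  constructor <;> linarith

lemma exists_le_mul_norm (h : IsNorm N) : ∃ C, 0 < C ∧ ∀ x, N x ≤ C * ‖x‖ := by
  refine ⟨1 + ∑ i, N (Pi.single i 1), ?_, fun x => ?_⟩
  · have : 0 ≤ ∑ i, N (Pi.single i (1 : ℝ)) := Finset.sum_nonneg fun i _ => h.nonneg _
    linarith
  · have key : ∀ s : Finset (Fin k),
        N (∑ i ∈ s, x i • Pi.single i (1 : ℝ)) ≤ (∑ i ∈ s, N (Pi.single i 1)) * ‖x‖ := by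
      intro s
      induction s using Finset.induction_on with
      | empty => simp [h.map_zero]
      | insert a s ha ih =>
        rw [Finset.sum_insert ha, Finset.sum_insert ha, add_mul]
        refine (h.2.2 _ _).trans (add_le_add ?_ ih)
        rw [h.2.1, mul_comm]
        exact mul_le_mul_of_nonneg_left (norm_le_pi_norm x a) (h.nonneg _)
    have hx : ∑ i, x i • Pi.single i (1 : ℝ) = x := by
      ext j
      simp [Finset.sum_apply, Pi.single_apply]
    have := key Finset.univ
    rw [hx] at this
    nlinarith [norm_nonneg x]

lemma continuous (h : IsNorm N) : Continuous N := by
  obtain ⟨C, hC, hN⟩ := h.exists_le_mul_norm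
  have : LipschitzWith C.toNNReal N := by
    refine LipschitzWith.of_dist_le_mul fun x y => ?_
    rw [Real.dist_eq, dist_eq_norm, Real.coe_toNNReal _ hC.le]
    exact (h.abs_sub_le x y).trans (hN _)
  exact this.continuous

lemma exists_mul_norm_le (h : IsNorm N) : ∃ c, 0 < c ∧ ∀ x, c * ‖x‖ ≤ N x := by
  rcases (Metric.sphere (0 : Fin k → ℝ) 1).eq_empty_or_nonempty with he | hne
  · refine ⟨1, one_pos, fun x => ?_⟩
    have hx : x = 0 := by
      by_contra hx
      have : ‖x‖⁻¹ • x ∈ Metric.sphere (0 : Fin k → ℝ) 1 := by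
        simp [norm_smul, norm_ne_zero_iff.2 hx]
      simp [he] at this
    simp [hx, h.map_zero]
  · obtain ⟨e, he, hmin⟩ := (isCompact_sphere (0 : Fin k → ℝ) 1).exists_isMinOn hne
      h.continuous.continuousOn
    have he1 : ‖e‖ = 1 := by simpa using he
    have hpos : 0 < N e := lt_of_le_of_ne (h.nonneg e) fun h0 => by
      rw [(h.1 e).1 h0.symm] at he1
      simp at he1
    refine ⟨N e, hpos, fun x => ?_⟩
    rcases eq_or_ne x 0 with rfl | hx
    · simp [h.map_zero]
    have hx' : 0 < ‖x‖ := norm_pos_iff.2 hx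
    have hs : ‖x‖⁻¹ • x ∈ Metric.sphere (0 : Fin k → ℝ) 1 := by
      simp [norm_smul, hx'.ne']
    have h1 : N e ≤ N (‖x‖⁻¹ • x) := hmin hs
    rw [h.2.1, abs_of_pos (inv_pos.2 hx'), inv_mul_eq_div, le_div_iff₀ hx'] at h1
    exact h1

end IsNorm

/-- The integer vectors `w` for which `w.1 • P₁ + w.2 • P₂` is an integer vector. -/
def integralLattice {m : ℕ} (P : (Fin m → ℚ) × (Fin m → ℚ)) : AddSubgroup (ℤ × ℤ) where
  carrier := {w | ∃ z : Fin m → ℤ, ∀ j, w.1 * P.1 j + w.2 * P.2 j + z j = 0}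
  zero_mem' := ⟨0, fun j => by simp⟩
  add_mem' := by
    rintro v w ⟨y, hy⟩ ⟨z, hz⟩
    refine ⟨y + z, fun j => ?_⟩
    have h1 := hy j
    have h2 := hz j
    push_cast [Prod.fst_add, Prod.snd_add, Pi.add_apply]
    linarith
  neg_mem' := by
    rintro w ⟨z, hz⟩
    refine ⟨-z, fun j => ?_⟩
    have h := hz j
    push_cast [Prod.fst_neg, Prod.snd_neg, Pi.neg_apply]
    linarith

/-- The determinant of two integer vectors in the plane. -/
def planeDet (v w : ℤ × ℤ) : ℤ := v.1 * w.2 - v.2 * w.1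

/-- `y` is a nonzero vector of the integral lattice of `P` generating its intersection with the
line through `y`. -/
def IsPrimitiveVector {m : ℕ} (P : (Fin m → ℚ) × (Fin m → ℚ)) (y : ℤ × ℤ) : Prop :=
  y ∈ integralLattice P ∧ y ≠ 0 ∧
    ∀ w ∈ integralLattice P, planeDet w y = 0 → ∃ k : ℤ, w = k • y

lemma exists_pos_smul_mem_integralLattice {m : ℕ} (P : (Fin m → ℚ) × (Fin m → ℚ)) :
    ∃ Q : ℤ, 0 < Q ∧ ∀ w : ℤ × ℤ, Q • w ∈ integralLattice P := by
  have key : ∀ a : Fin m → ℚ, ∃ Q : ℤ, 0 < Q ∧ ∀ j, ∃ z : ℤ, Q * a j = z := by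
    intro a
    refine ⟨∏ j, (a j).den, Finset.prod_pos fun j _ => by exact_mod_cast (a j).den_pos,
      fun j => ?_⟩
    refine ⟨(∏ i ∈ Finset.univ.erase j, ((a i).den : ℤ)) * (a j).num, ?_⟩
    rw [← Finset.mul_prod_erase Finset.univ (fun i => ((a i).den : ℤ)) (Finset.mem_univ j)]
    have := Rat.den_mul_eq_num (a j)
    push_cast
    linear_combination (∏ i ∈ Finset.univ.erase j, ((a i).den : ℚ)) * this
  obtain ⟨Q₁, h1, hz1⟩ := key P.1
  obtain ⟨Q₂, h2, hz2⟩ := key P.2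
  choose z1 hz1 using hz1
  choose z2 hz2 using hz2
  refine ⟨Q₁ * Q₂, mul_pos h1 h2, fun w =>
    ⟨fun j => -(w.1 * Q₂ * z1 j + w.2 * Q₁ * z2 j), fun j => ?_⟩⟩
  have e1 := hz1 j
  have e2 := hz2 j
  simp only [Prod.smul_fst, Prod.smul_snd, smul_eq_mul]
  push_cast
  linear_combination (w.1 : ℚ) * Q₂ * e1 + (w.2 : ℚ) * Q₁ * e2

lemma IsPrimitiveVector.exists_basis {m : ℕ} {P : (Fin m → ℚ) × (Fin m → ℚ)} {y : ℤ × ℤ}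
    (h : IsPrimitiveVector P y) :
    ∃ u ∈ integralLattice P, 0 < planeDet u y ∧
      ∀ w ∈ integralLattice P, ∃ α β : ℤ, w = α • u + β • y := by
  obtain ⟨hy, hy0, hprim⟩ := h
  let φ : ℤ × ℤ →+ ℤ :=
    { toFun := fun w => planeDet w y
      map_zero' := by simp [planeDet]
      map_add' := fun v w => by simp [planeDet]; ring }
  obtain ⟨g, hg⟩ := Int.subgroup_cyclic ((integralLattice P).map φ)
  have hmem : ∀ w ∈ integralLattice P, g ∣ planeDet w y := by
    intro w hw
    have : φ w ∈ (integralLattice P).map φ := AddSubgroup.mem_map_of_mem φ hw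
    rw [hg, AddSubgroup.mem_closure_singleton] at this
    obtain ⟨n, hn⟩ := this
    exact ⟨n, by rw [mul_comm]; exact (by simpa using hn.symm : φ w = n * g)⟩
  have hg0 : g ≠ 0 := by
    rintro rfl
    obtain ⟨Q, hQ, hQm⟩ := exists_pos_smul_mem_integralLattice P
    have h1 := zero_dvd_iff.1 (hmem _ (hQm (1, 0)))
    have h2 := zero_dvd_iff.1 (hmem _ (hQm (0, 1)))
    simp [planeDet, hQ.ne'] at h1 h2
    exact hy0 (Prod.ext h2 h1)
  have habs : |g| ∈ (integralLattice P).map φ := by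
    have : g ∈ (integralLattice P).map φ := by
      rw [hg]; exact AddSubgroup.mem_closure_singleton_self g
    rcases abs_choice g with h | h <;> rw [h]
    · exact this
    · exact neg_mem this
  obtain ⟨u, hu, hug⟩ := habs
  have hug' : planeDet u y = |g| := hug
  refine ⟨u, hu, hug' ▸ abs_pos.2 hg0, fun w hw => ?_⟩
  obtain ⟨α, hα⟩ := (abs_dvd g _).2 (hmem w hw)
  have hdiff : w - α • u ∈ integralLattice P := sub_mem hw (zsmul_mem hu α)
  obtain ⟨β, hβ⟩ := hprim _ hdiff (by
    rw [← hug'] at hα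
    simp only [planeDet, Prod.fst_sub, Prod.snd_sub, Prod.smul_fst, Prod.smul_snd,
      smul_eq_mul] at hα ⊢
    linear_combination hα)
  exact ⟨α, β, by rw [← hβ]; abel⟩

/-- A family of weights on the integer plane behaving like a norm. -/
def IsPlaneWeight (κ : ℝ) (ν : ℤ × ℤ → ℝ) : Prop :=
  0 < κ ∧ (∀ w : ℤ × ℤ, κ * |(w.1 : ℝ)| ≤ ν w ∧ κ * |(w.2 : ℝ)| ≤ ν w) ∧
    ∀ (k : ℤ) (w : ℤ × ℤ), ν (k • w) = |(k : ℝ)| * ν w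

namespace IsPlaneWeight

variable {κ : ℝ} {ν : ℤ × ℤ → ℝ}

lemma nonneg (h : IsPlaneWeight κ ν) (w : ℤ × ℤ) : 0 ≤ ν w :=
  (mul_nonneg h.1.le (abs_nonneg _)).trans (h.2.1 w).1

lemma abs_planeDet_le (h : IsPlaneWeight κ ν) (v w : ℤ × ℤ) :
    |(planeDet v w : ℝ)| ≤ 2 / κ ^ 2 * (ν v * ν w) := by
  have hκ := h.1
  have hl := h.2.1
  have h1 := mul_le_mul (hl v).1 (hl w).2 (mul_nonneg hκ.le (abs_nonneg _)) (h.nonneg v)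
  have h2 := mul_le_mul (hl v).2 (hl w).1 (mul_nonneg hκ.le (abs_nonneg _)) (h.nonneg v)
  rw [div_mul_eq_mul_div, le_div_iff₀ (by positivity)]
  have h3 : |(planeDet v w : ℝ)| ≤ |(v.1 : ℝ)| * |(w.2 : ℝ)| + |(v.2 : ℝ)| * |(w.1 : ℝ)| := by
    rw [planeDet]
    push_cast
    rw [← abs_mul, ← abs_mul]
    exact abs_sub _ _
  nlinarith [mul_le_mul_of_nonneg_right h3 (sq_nonneg κ)]

/-- Moving along the line through `u` in direction `y` eventually gives large vectors whose
direction avoids any prescribed nonzero functional. -/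
lemma exists_shift (h : IsPlaneWeight κ ν) {m : ℕ} {u y : ℤ × ℤ} (hd : 0 < planeDet u y)
    (L : ℝ) (l : (Fin m → ℚ) × (Fin m → ℚ)) :
    ∃ M : ℤ, L ≤ ν (u + M • y) ∧ (l ≠ 0 →
      ∃ j, l.1 j * (u + M • y).2 - l.2 j * (u + M • y).1 ≠ 0) := by
  have aux : ∀ (R : Type) [Field R] [LinearOrder R] [IsStrictOrderedRing R] [Archimedean R]
      (a b L : R), b ≠ 0 → ∀ᶠ M : ℕ in atTop, L ≤ |a + M * b| := by
    intro R _ _ _ _ a b L hb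
    obtain ⟨M₀, hM₀⟩ := exists_nat_ge ((L + |a|) / |b|)
    filter_upwards [eventually_ge_atTop M₀] with M hM
    have hb' : 0 < |b| := abs_pos.2 hb
    rw [div_le_iff₀ hb'] at hM₀
    have h1 : (M₀ : R) ≤ M := by exact_mod_cast hM
    have h2 := mul_le_mul_of_nonneg_right h1 hb'.le
    have h3 : |(M : R) * b| ≤ |a + M * b| + |a| := by
      have := abs_sub (a + M * b) a
      simpa using this
    rw [abs_mul, Nat.abs_cast] at h3
    linarith
  have hν : ∀ᶠ M : ℕ in atTop, L ≤ ν (u + (M : ℤ) • y) := by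
    have hy : y.1 ≠ 0 ∨ y.2 ≠ 0 := by
      by_contra! hy
      simp [planeDet, hy.1, hy.2] at hd
    rcases hy with hy | hy
    · filter_upwards [aux ℝ u.1 y.1 (L / κ) (by exact_mod_cast hy)] with M hM
      refine le_trans ?_ (h.2.1 _).1
      rw [div_le_iff₀' h.1] at hM
      simpa using hM
    · filter_upwards [aux ℝ u.2 y.2 (L / κ) (by exact_mod_cast hy)] with M hM
      refine le_trans ?_ (h.2.1 _).2
      rw [div_le_iff₀' h.1] at hM
      simpa using hM
  by_cases hl : l = 0
  · obtain ⟨M, hM⟩ := hν.exists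
    exact ⟨M, hM, fun h => absurd hl h⟩
  obtain ⟨j, hj⟩ : ∃ j, l.1 j ≠ 0 ∨ l.2 j ≠ 0 := by
    by_contra! hcon
    exact hl (Prod.ext (funext fun j => (hcon j).1) (funext fun j => (hcon j).2))
  have hg : ∀ᶠ M : ℕ in atTop,
      l.1 j * ((u + (M : ℤ) • y).2 : ℚ) - l.2 j * ((u + (M : ℤ) • y).1 : ℚ) ≠ 0 := by
    by_cases hb : l.1 j * y.2 - l.2 j * y.1 = 0
    · refine Eventually.of_forall fun M hM => ?_
      simp only [Prod.fst_add, Prod.snd_add, Prod.smul_fst, Prod.smul_snd, smul_eq_mul] at hM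
      push_cast at hM
      have ha : l.1 j * u.2 - l.2 j * u.1 = 0 := by linear_combination hM - M * hb
      have hd' : ((u.1 : ℚ) * y.2 - u.2 * y.1) ≠ 0 := by
        have := hd.ne'
        rw [planeDet] at this
        exact_mod_cast this
      have e1 : l.1 j * ((u.1 : ℚ) * y.2 - u.2 * y.1) = 0 := by
        linear_combination (u.1 : ℚ) * hb - (y.1 : ℚ) * ha
      have e2 : l.2 j * ((u.1 : ℚ) * y.2 - u.2 * y.1) = 0 := by
        linear_combination (u.2 : ℚ) * hb - (y.2 : ℚ) * ha
      have e1' := (mul_eq_zero.1 e1).resolve_right hd'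
      have e2' := (mul_eq_zero.1 e2).resolve_right hd'
      tauto
    · filter_upwards [aux ℚ (l.1 j * u.2 - l.2 j * u.1) _ 1 hb] with M hM h0
      simp only [Prod.fst_add, Prod.snd_add, Prod.smul_fst, Prod.smul_snd, smul_eq_mul] at h0
      push_cast at h0
      rw [show l.1 j * (u.2 : ℚ) - l.2 j * u.1 + M * (l.1 j * y.2 - l.2 j * y.1) = 0 by
        linear_combination h0] at hM
      norm_num at hM
  obtain ⟨M, hM1, hM2⟩ := (hν.and hg).exists
  exact ⟨M, hM1, fun _ => ⟨j, hM2⟩⟩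

end IsPlaneWeight

/-- Rational points of a norm shell avoiding a hyperplane. -/
lemma IsNorm.exists_rat_shell {m : ℕ} (hm : 0 < m) {N : (Fin m → ℝ) → ℝ} (hN : IsNorm N)
    {A B : ℝ} (hA : 0 ≤ A) (hAB : A < B) (h : ℚ) (g : Fin m → ℚ) :
    ∃ v : Fin m → ℚ, A < N (fun j => (v j : ℝ)) ∧ N (fun j => (v j : ℝ)) < B ∧
      (g ≠ 0 → h + ∑ j, g j * v j ≠ 0) := by
  have hU : IsOpen {v : Fin m → ℝ | A < N v ∧ N v < B} :=
    (isOpen_lt continuous_const hN.continuous).inter (isOpen_lt hN.continuous continuous_const)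
  obtain ⟨v₀, hv₀⟩ : ∃ v : Fin m → ℝ, A < N v ∧ N v < B := by
    let e : Fin m → ℝ := fun _ => 1
    have he : 0 < N e := by
      refine lt_of_le_of_ne (hN.nonneg e) fun h0 => ?_
      have := congrFun ((hN.1 e).1 h0.symm) ⟨0, hm⟩
      simp [e] at this
    refine ⟨((A + B) / 2 / N e) • e, ?_⟩
    rw [hN.2.1, abs_of_nonneg (div_nonneg (by linarith) he.le), div_mul_cancel₀ _ he.ne']
    constructor <;> linarith
  have hdense : DenseRange (fun (v : Fin m → ℚ) j => (v j : ℝ)) :=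
    DenseRange.piMap (fun _ => Rat.denseRange_cast)
  by_cases hg : g = 0
  · obtain ⟨v, hv⟩ := hdense.exists_mem_open hU ⟨v₀, hv₀⟩
    exact ⟨v, hv.1, hv.2, fun h => absurd hg h⟩
  obtain ⟨i, hi⟩ : ∃ i, g i ≠ 0 := by
    by_contra! hcon
    exact hg (funext hcon)
  let F : (Fin m → ℝ) → ℝ := fun v => h + ∑ j, (g j : ℝ) * v j
  have hF : Continuous F := by fun_prop
  have hV : IsOpen ({v : Fin m → ℝ | A < N v ∧ N v < B} ∩ {v | F v ≠ 0}) :=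
    hU.inter (isOpen_ne_fun hF continuous_const)
  obtain ⟨v₁, hv₁⟩ :
      ({v : Fin m → ℝ | A < N v ∧ N v < B} ∩ {v | F v ≠ 0}).Nonempty := by
    by_cases hF0 : F v₀ = 0
    · have hc : Continuous fun t : ℝ => v₀ + t • Pi.single i (1 : ℝ) := by fun_prop
      have h0 : ∀ᶠ t : ℝ in nhds 0, v₀ + t • Pi.single i (1 : ℝ) ∈
          {v : Fin m → ℝ | A < N v ∧ N v < B} := by
        refine hc.continuousAt.eventually_mem (hU.mem_nhds ?_)
        simpa using hv₀
      obtain ⟨t, ht, ht0⟩ :=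
        ((h0.filter_mono nhdsWithin_le_nhds).and (self_mem_nhdsWithin (s := {(0 : ℝ)}ᶜ))).exists
      refine ⟨_, ht, ?_⟩
      have : F (v₀ + t • Pi.single i (1 : ℝ)) = F v₀ + t * g i := by
        simp only [F, Pi.add_apply, Pi.smul_apply, smul_eq_mul, mul_add, Finset.sum_add_distrib]
        simp [Pi.single_apply]
        ring
      rw [Set.mem_ofPred_eq, this, hF0, zero_add]
      exact mul_ne_zero ht0 (by exact_mod_cast hi)
    · exact ⟨v₀, hv₀, hF0⟩
  obtain ⟨v, hv⟩ := hdense.exists_mem_open hV ⟨v₁, hv₁⟩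
  refine ⟨v, hv.1.1, hv.1.2, fun _ h0 => hv.2 ?_⟩
  simp only [F]
  exact_mod_cast h0

/-- The vector `w.1 • β₁ + w.2 • β₂ + z`. -/
def evalForm {m : ℕ} (β : (Fin m → ℝ) × (Fin m → ℝ)) (w : ℤ × ℤ) (z : Fin m → ℤ) : Fin m → ℝ :=
  fun j => w.1 * β.1 j + w.2 * β.2 j + z j

/-- The real pair underlying a pair of rational vectors. -/
def realPair {m : ℕ} (P : (Fin m → ℚ) × (Fin m → ℚ)) : (Fin m → ℝ) × (Fin m → ℝ) :=
  (fun j => (P.1 j : ℝ), fun j => (P.2 j : ℝ))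

/-- The perturbation of `P` in direction `v` which does not change the value at `y`. -/
def shear {m : ℕ} (P : (Fin m → ℚ) × (Fin m → ℚ)) (y : ℤ × ℤ) (v : Fin m → ℚ) :
    (Fin m → ℚ) × (Fin m → ℚ) :=
  (P.1 + (y.2 : ℚ) • v, P.2 - (y.1 : ℚ) • v)

lemma evalForm_shear {m : ℕ} (P : (Fin m → ℚ) × (Fin m → ℚ)) (y w : ℤ × ℤ) (v : Fin m → ℚ)
    (z : Fin m → ℤ) :
    evalForm (realPair (shear P y v)) w z =
      evalForm (realPair P) w z + (planeDet w y : ℝ) • (fun j => (v j : ℝ)) := by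
  ext j
  simp only [evalForm, realPair, shear, planeDet, Pi.add_apply, Pi.sub_apply, Pi.smul_apply,
    smul_eq_mul]
  push_cast
  ring

lemma evalForm_realPair_eq_zero_iff {m : ℕ} {P : (Fin m → ℚ) × (Fin m → ℚ)} {w : ℤ × ℤ}
    {z : Fin m → ℤ} :
    evalForm (realPair P) w z = 0 ↔ ∀ j, (w.1 * P.1 j + w.2 * P.2 j + z j : ℚ) = 0 := by
  rw [funext_iff]
  refine forall_congr' fun j => ?_
  simp only [evalForm, realPair, Pi.zero_apply]
  exact_mod_cast Iff.rfl

lemma planeDet_eq_zero_of_smul_add {u y : ℤ × ℤ} (M : ℤ) :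
    planeDet y (u + M • y) = -planeDet u y := by
  simp only [planeDet, Prod.fst_add, Prod.snd_add, Prod.smul_fst, Prod.smul_snd, smul_eq_mul]
  ring

lemma IsPlaneWeight.le_evalForm_shear {κ : ℝ} {ν : ℤ × ℤ → ℝ} (hν : IsPlaneWeight κ ν) {m : ℕ}
    {N : (Fin m → ℝ) → ℝ} (hN : IsNorm N) {C : ℝ} (hC : 0 < C) (hCN : ∀ x, C * ‖x‖ ≤ N x)
    {P : (Fin m → ℚ) × (Fin m → ℚ)} {u y : ℤ × ℤ} (hu : u ∈ integralLattice P)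
    (hy : y ∈ integralLattice P) (hd : 0 < planeDet u y)
    (hbasis : ∀ w ∈ integralLattice P, ∃ α β : ℤ, w = α • u + β • y) (M : ℤ) (v : Fin m → ℚ)
    (hbound : N (fun j => (v j : ℝ)) *
      (planeDet u y * (2 / κ ^ 2 * ν (u + M • y) ^ 2 + planeDet u y)) ≤ C)
    {w : ℤ × ℤ} (hw : w ≠ 0) (hwy : ν w < ν (u + M • y)) (z : Fin m → ℤ) :
    N (fun j => (v j : ℝ)) * planeDet u y ≤
      N (evalForm (realPair (shear P (u + M • y) v)) w z) := by
  set y' := u + M • y with hy'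
  set X := N (fun j => (v j : ℝ)) with hX
  have hX0 : 0 ≤ X := hN.nonneg _
  set d := planeDet u y with hdd
  have hd' : (0 : ℝ) < d := by exact_mod_cast hd
  rw [evalForm_shear]
  by_cases h0 : evalForm (realPair P) w z = 0
  · rw [h0, zero_add, hN.2.1]
    obtain ⟨α, β, hαβ⟩ := hbasis w ⟨z, evalForm_realPair_eq_zero_iff.1 h0⟩
    have hdet : planeDet w y' = -((β - α * M) * d) := by
      rw [hαβ, hy', hdd]
      simp only [planeDet, Prod.fst_add, Prod.snd_add, Prod.smul_fst, Prod.smul_snd, smul_eq_mul]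
      ring
    by_cases hk : β - α * M = 0
    · exfalso
      have hw' : w = α • y' := by
        rw [hαβ, hy', smul_add, smul_smul, sub_eq_zero.1 hk]
      have hα : α ≠ 0 := by
        rintro rfl
        exact hw (by simpa using hw')
      rw [hw', hν.2.2] at hwy
      have h1 : (1 : ℝ) ≤ |(α : ℝ)| := by exact_mod_cast Int.one_le_abs hα
      nlinarith [hν.nonneg y']
    · rw [hdet]
      have h1 : (1 : ℝ) ≤ |((β - α * M : ℤ) : ℝ)| := by exact_mod_cast Int.one_le_abs hk
      rw [Int.cast_neg, abs_neg, Int.cast_mul, abs_mul, abs_of_pos hd', mul_comm X]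
      refine mul_le_mul_of_nonneg_right ?_ hX0
      nlinarith
  · have hdw : d • w ∈ integralLattice P := by
      have : d • w = planeDet w y • u + planeDet u w • y := by
        rw [hdd]
        ext <;> simp only [planeDet, Prod.fst_add, Prod.snd_add, Prod.smul_fst, Prod.smul_snd,
          smul_eq_mul] <;> ring
      rw [this]
      exact add_mem (zsmul_mem hu _) (zsmul_mem hy _)
    obtain ⟨z', hz'⟩ := hdw
    obtain ⟨j, hj⟩ := Function.ne_iff.1 h0
    have hint : d * evalForm (realPair P) w z j = ((d * z j - z' j : ℤ) : ℝ) := by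
      have h := hz' j
      simp only [Prod.smul_fst, Prod.smul_snd, smul_eq_mul] at h
      have h' : (((d * w.1 : ℤ) : ℝ) * (P.1 j : ℝ) + ((d * w.2 : ℤ) : ℝ) * (P.2 j : ℝ)
        + (z' j : ℝ)) = 0 := by exact_mod_cast h
      simp only [evalForm, realPair]
      push_cast at h' ⊢
      linear_combination h'
    have hne : d * z j - z' j ≠ 0 := by
      intro h
      rw [h, Int.cast_zero] at hint
      exact hj ((mul_eq_zero.1 hint).resolve_left hd'.ne')
    have h1 : (1 : ℝ) ≤ d * |evalForm (realPair P) w z j| := by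
      rw [← abs_of_pos hd', ← abs_mul, hint]
      exact_mod_cast Int.one_le_abs hne
    have h2 : C ≤ d * N (evalForm (realPair P) w z) := by
      have h3 := hCN (evalForm (realPair P) w z)
      have h4 := norm_le_pi_norm (evalForm (realPair P) w z) j
      rw [Real.norm_eq_abs] at h4
      have h5 := mul_le_mul_of_nonneg_left h4 hd'.le
      nlinarith
    have h3 : N (evalForm (realPair P) w z) ≤
        N (evalForm (realPair P) w z + (planeDet w y' : ℝ) • fun j => (v j : ℝ)) +
          |(planeDet w y' : ℝ)| * X := by
      have := hN.2.2 (evalForm (realPair P) w z + (planeDet w y' : ℝ) • fun j => (v j : ℝ))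
        (-((planeDet w y' : ℝ) • fun j => (v j : ℝ)))
      rwa [add_neg_cancel_right, hN.map_neg, hN.2.1] at this
    have h4 : |(planeDet w y' : ℝ)| ≤ 2 / κ ^ 2 * ν y' ^ 2 := by
      refine (hν.abs_planeDet_le w y').trans ?_
      have : ν w * ν y' ≤ ν y' ^ 2 := by nlinarith [hν.nonneg y']
      have hκ := hν.1
      gcongr
    have h5 := mul_le_mul_of_nonneg_right h4 hX0
    have h6 : d * (X * d) ≤
        d * N (evalForm (realPair P) w z + (planeDet w y' : ℝ) • fun j => (v j : ℝ)) := by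
      nlinarith [mul_le_mul_of_nonneg_left h3 hd'.le, mul_le_mul_of_nonneg_left h5 hd'.le]
    exact le_of_mul_le_mul_left h6 hd'

lemma continuous_evalForm {m : ℕ} (w : ℤ × ℤ) (z : Fin m → ℤ) :
    Continuous fun β : (Fin m → ℝ) × (Fin m → ℝ) => evalForm β w z := by
  unfold evalForm
  fun_prop

lemma isPrimitiveVector_shear {m : ℕ} {P : (Fin m → ℚ) × (Fin m → ℚ)} {u y : ℤ × ℤ}
    (hu : u ∈ integralLattice P) (hy : y ∈ integralLattice P) (hd : 0 < planeDet u y)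
    (hbasis : ∀ w ∈ integralLattice P, ∃ α β : ℤ, w = α • u + β • y) (M : ℤ)
    (v : Fin m → ℚ) : IsPrimitiveVector (shear P (u + M • y) v) (u + M • y) := by
  have hiff : ∀ w : ℤ × ℤ, planeDet w (u + M • y) = 0 →
      (w ∈ integralLattice (shear P (u + M • y) v) ↔ w ∈ integralLattice P) := by
    intro w hw
    refine exists_congr fun z => ?_
    rw [← evalForm_realPair_eq_zero_iff, ← evalForm_realPair_eq_zero_iff, evalForm_shear, hw,
      Int.cast_zero, zero_smul, add_zero]
  refine ⟨(hiff _ (by simp [planeDet, mul_comm])).2 (add_mem hu (zsmul_mem hy M)), ?_,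
    fun w hw hw0 => ?_⟩
  · intro h0
    have := planeDet_eq_zero_of_smul_add (u := u) (y := y) M
    rw [h0] at this
    simp [planeDet] at this hd
    omega
  · obtain ⟨α, β, hαβ⟩ := hbasis w ((hiff w hw0).1 hw)
    have hdet : planeDet w (u + M • y) = -((β - α * M) * planeDet u y) := by
      rw [hαβ]
      simp only [planeDet, Prod.fst_add, Prod.snd_add, Prod.smul_fst, Prod.smul_snd, smul_eq_mul]
      ring
    rw [hdet, neg_eq_zero, mul_eq_zero] at hw0
    have hk := hw0.resolve_right hd.ne'
    exact ⟨α, by rw [hαβ, smul_add, smul_smul, sub_eq_zero.1 hk]⟩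

/-- The inductive step in the construction of a pair with prescribed uniform approximation. -/
lemma IsPlaneWeight.exists_next {κ : ℝ} {ν : ℤ × ℤ → ℝ} (hν : IsPlaneWeight κ ν) {m : ℕ}
    (hm : 0 < m) {N : (Fin m → ℝ) → ℝ} (hN : IsNorm N) {C : ℝ} (hC : 0 < C)
    (hCN : ∀ x, C * ‖x‖ ≤ N x) {s : ℝ} (hs : 2 ≤ s) {c ε : ℝ} (hc : 0 ≤ c) (hε : 0 < ε)
    (hcε : c + ε ≤ C * κ ^ 2 / 4)
    {P : (Fin m → ℚ) × (Fin m → ℚ)} {y : ℤ × ℤ} (hPy : IsPrimitiveVector P y)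
    {r : ℝ} (hr : 0 < r) (L : ℝ) (h : ℚ) (l : (Fin m → ℚ) × (Fin m → ℚ)) :
    ∃ (P' : (Fin m → ℚ) × (Fin m → ℚ)) (y' : ℤ × ℤ) (r' : ℝ), IsPrimitiveVector P' y' ∧ 0 < r' ∧
      Metric.closedBall (realPair P') r' ⊆ Metric.closedBall (realPair P) r ∧ L ≤ ν y' ∧
      ∀ β ∈ Metric.closedBall (realPair P') r',
        (∃ z, N (evalForm β y z) * ν y' ^ s < c + ε) ∧
        (∀ w ≠ 0, ν w < ν y' → ∀ z, c < N (evalForm β w z) * ν y' ^ s) ∧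
        (l ≠ 0 → (h : ℝ) + ∑ j, (l.1 j * β.1 j + l.2 j * β.2 j) ≠ 0) := by
  have hκ := hν.1
  obtain ⟨u, hu, hd, hbasis⟩ := hPy.exists_basis
  have hd' : (0 : ℝ) < planeDet u y := by exact_mod_cast hd
  have hd1 : (1 : ℝ) ≤ planeDet u y := by exact_mod_cast hd
  obtain ⟨M, hM, hl⟩ := hν.exists_shift (m := m) hd (max (max L 1) (max (ν y) (κ / r))) l
  simp only [max_le_iff] at hM
  obtain ⟨⟨hL, h1⟩, hyy', hκr⟩ := hM
  set y' := u + M • y with hy'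
  have hy'0 : 0 < ν y' := by linarith
  set lam := ν y' ^ s with hlam
  have hlam_ge : ν y' ^ 2 ≤ lam := by
    rw [hlam, ← Real.rpow_natCast]
    exact Real.rpow_le_rpow_of_exponent_le h1 (by simpa using hs)
  have hlam0 : 0 < lam := lt_of_lt_of_le (by positivity) hlam_ge
  have hld : 0 < lam * planeDet u y := mul_pos hlam0 hd'
  obtain ⟨v, hv1, hv2, hv3⟩ := hN.exists_rat_shell hm (A := c / (lam * planeDet u y))
    (B := (c + ε) / (lam * planeDet u y)) (by positivity)
    (div_lt_div_of_pos_right (by linarith) hld)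
    (h + ∑ j, (l.1 j * P.1 j + l.2 j * P.2 j)) (fun j => l.1 j * y'.2 - l.2 j * y'.1)
  rw [div_lt_iff₀ hld] at hv1
  rw [lt_div_iff₀ hld] at hv2
  set X := N (fun j => (v j : ℝ)) with hX
  have hX0 : 0 ≤ X := hN.nonneg _
  set d : ℝ := (planeDet u y : ℝ) with hdd
  set P' := shear P y' v with hP'
  obtain ⟨z₀, hz₀⟩ := hPy.1
  have hval : N (evalForm (realPair P') y z₀) = X * d := by
    rw [hP', evalForm_shear, evalForm_realPair_eq_zero_iff.2 hz₀, zero_add, hN.2.1, hy',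
      planeDet_eq_zero_of_smul_add, Int.cast_neg, abs_neg, abs_of_pos hd', mul_comm]
  have hdle : d ≤ 2 / κ ^ 2 * ν y' ^ 2 := by
    have h3 := hν.abs_planeDet_le y y'
    rw [hy', planeDet_eq_zero_of_smul_add, Int.cast_neg, abs_neg, abs_of_pos hd', ← hy'] at h3
    refine h3.trans ?_
    have : ν y * ν y' ≤ ν y' ^ 2 := by nlinarith
    gcongr
  have hbound : X * (d * (2 / κ ^ 2 * ν y' ^ 2 + d)) ≤ C := by
    calc X * (d * (2 / κ ^ 2 * ν y' ^ 2 + d))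
        ≤ X * (d * (2 / κ ^ 2 * ν y' ^ 2 + 2 / κ ^ 2 * ν y' ^ 2)) := by gcongr
      _ = X * (ν y' ^ 2 * d) * (4 / κ ^ 2) := by ring
      _ ≤ X * (lam * d) * (4 / κ ^ 2) := by gcongr
      _ ≤ (C * κ ^ 2 / 4) * (4 / κ ^ 2) := by
          have : X * (lam * d) ≤ C * κ ^ 2 / 4 := by linarith
          gcongr
      _ = C := by field_simp
  have hdist : dist (realPair P') (realPair P) < r := by
    have hXν : X * ν y' ^ 2 < C * κ ^ 2 := by
      have e1 : X * ν y' ^ 2 ≤ X * (lam * d) := by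
        gcongr
        nlinarith
      have e2 : 0 < C * κ ^ 2 := by positivity
      linarith
    have hvj : ∀ j (a : ℝ), κ * |a| ≤ ν y' → |a * v j| < r := by
      intro j a ha
      have e1 : C * |(v j : ℝ)| ≤ X := by
        refine le_trans ?_ (hCN _)
        rw [← Real.norm_eq_abs]
        exact mul_le_mul_of_nonneg_left (norm_le_pi_norm (fun j => (v j : ℝ)) j) hC.le
      rw [div_le_iff₀ hr] at hκr
      rw [abs_mul]
      have e2 : (κ * |a|) * (C * |(v j : ℝ)|) ≤ ν y' * X :=
        mul_le_mul ha e1 (by positivity) hy'0.le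
      have e3 : ν y' * (ν y' * X) < ν y' * (κ * C * r) := by
        calc ν y' * (ν y' * X) = X * ν y' ^ 2 := by ring
          _ < C * κ ^ 2 := hXν
          _ = κ * C * κ := by ring
          _ ≤ κ * C * (ν y' * r) := by gcongr
          _ = _ := by ring
      have e4 := lt_of_mul_lt_mul_left e3 hy'0.le
      have e5 : (κ * C) * (|a| * |(v j : ℝ)|) < (κ * C) * r := by linarith
      exact lt_of_mul_lt_mul_left e5 (by positivity)
    rw [Prod.dist_eq, max_lt_iff]
    constructor
    · refine (dist_pi_lt_iff hr).2 fun j => ?_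
      have := hvj j y'.2 (hν.2.1 y').2
      rw [Real.dist_eq]
      convert this using 2
      simp [realPair, hP', shear]
    · refine (dist_pi_lt_iff hr).2 fun j => ?_
      have := hvj j y'.1 (hν.2.1 y').1
      rw [dist_comm, Real.dist_eq]
      convert this using 2
      simp [realPair, hP', shear]
  have hlow : ∀ w ≠ 0, ν w < ν y' → ∀ z, X * d ≤ N (evalForm (realPair P') w z) :=
    fun w hw hwy z => hν.le_evalForm_shear hN hC hCN hu hPy.1 hd hbasis M v hbound hw hwy z
  have ev1 : ∀ᶠ β in nhds (realPair P'), dist β (realPair P) < r :=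
    (isOpen_lt (continuous_id.dist continuous_const) continuous_const).mem_nhds hdist
  have ev2 : ∀ᶠ β in nhds (realPair P'), N (evalForm β y z₀) * lam < c + ε := by
    refine (isOpen_lt ((hN.continuous.comp (continuous_evalForm y z₀)).mul continuous_const)
      continuous_const).mem_nhds ?_
    change N (evalForm (realPair P') y z₀) * lam < c + ε
    rw [hval]
    linarith
  obtain ⟨C₂, hC₂, hNC₂⟩ := hN.exists_le_mul_norm
  have ev3 : ∀ᶠ β in nhds (realPair P'),
      C₂ * (2 * (ν y' / κ) * dist β (realPair P')) * lam < X * d * lam - c := by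
    refine (isOpen_lt (by fun_prop) continuous_const).mem_nhds ?_
    change C₂ * (2 * (ν y' / κ) * dist (realPair P') (realPair P')) * lam < X * d * lam - c
    rw [dist_self]
    linarith
  have ev4 : ∀ᶠ β : (Fin m → ℝ) × (Fin m → ℝ) in nhds (realPair P'),
      l ≠ 0 → (h : ℝ) + ∑ j, (l.1 j * β.1 j + l.2 j * β.2 j) ≠ 0 := by
    by_cases hl0 : l = 0
    · exact Eventually.of_forall fun _ hne => absurd hl0 hne
    obtain ⟨j, hj⟩ := hl hl0
    have hne := hv3 (fun h0 => hj (congrFun h0 j))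
    have : ∀ᶠ β : (Fin m → ℝ) × (Fin m → ℝ) in nhds (realPair P'),
        (h : ℝ) + ∑ j, (l.1 j * β.1 j + l.2 j * β.2 j) ≠ 0 := by
      refine (isOpen_ne_fun (by fun_prop) continuous_const).mem_nhds ?_
      change (h : ℝ) + ∑ j, (l.1 j * (P'.1 j : ℝ) + l.2 j * (P'.2 j : ℝ)) ≠ 0
      have e : h + ∑ j, (l.1 j * P'.1 j + l.2 j * P'.2 j) ≠ 0 := by
        convert hne using 1
        rw [add_assoc, ← Finset.sum_add_distrib]
        congr 1
        refine Finset.sum_congr rfl fun j _ => ?_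
        simp only [hP', shear, Pi.add_apply, Pi.sub_apply, Pi.smul_apply, smul_eq_mul]
        ring
      exact_mod_cast e
    exact this.mono fun _ hβ _ => hβ
  obtain ⟨r', hr', hball⟩ := Metric.nhds_basis_closedBall.eventually_iff.1
    (ev1.and (ev2.and (ev3.and ev4)))
  refine ⟨P', y', r', isPrimitiveVector_shear hu hPy.1 hd hbasis M v, hr',
    fun β hβ => (hball hβ).1.le, hL, fun β hβ => ?_⟩
  obtain ⟨-, h2, h3, h4⟩ := hball hβ
  refine ⟨⟨z₀, h2⟩, fun w hw hwy z => ?_, h4⟩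
  have e1 := hN.abs_sub_le (evalForm (realPair P') w z) (evalForm β w z)
  have e2 : ‖evalForm (realPair P') w z - evalForm β w z‖ ≤
      2 * (ν y' / κ) * dist β (realPair P') := by
    refine (pi_norm_le_iff_of_nonneg (by positivity)).2 fun j => ?_
    have a1 : |(w.1 : ℝ)| ≤ ν y' / κ := by
      rw [le_div_iff₀' hκ]; exact (hν.2.1 w).1.trans hwy.le
    have a2 : |(w.2 : ℝ)| ≤ ν y' / κ := by
      rw [le_div_iff₀' hκ]; exact (hν.2.1 w).2.trans hwy.le
    have b1 : |(realPair P').1 j - β.1 j| ≤ dist β (realPair P') := by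
      rw [dist_comm, ← Real.dist_eq]
      exact (dist_le_pi_dist _ _ j).trans (le_max_left _ _)
    have b2 : |(realPair P').2 j - β.2 j| ≤ dist β (realPair P') := by
      rw [dist_comm, ← Real.dist_eq]
      exact (dist_le_pi_dist _ _ j).trans (le_max_right _ _)
    rw [Real.norm_eq_abs, show (evalForm (realPair P') w z - evalForm β w z) j =
      w.1 * ((realPair P').1 j - β.1 j) + w.2 * ((realPair P').2 j - β.2 j) by
        simp only [evalForm, Pi.sub_apply]; ring]
    refine (abs_add_le _ _).trans ?_
    rw [abs_mul, abs_mul]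
    have c1 := mul_le_mul a1 b1 (abs_nonneg _) (by positivity)
    have c2 := mul_le_mul a2 b2 (abs_nonneg _) (by positivity)
    linarith
  have e3 := (hNC₂ (evalForm (realPair P') w z - evalForm β w z)).trans
    (mul_le_mul_of_nonneg_left e2 hC₂.le)
  have e4 := hlow w hw hwy z
  have e5 := le_abs_self (N (evalForm (realPair P') w z) - N (evalForm β w z))
  have e6 : X * d - C₂ * (2 * (ν y' / κ) * dist β (realPair P')) ≤ N (evalForm β w z) := by
    linarith
  have e7 := mul_le_mul_of_nonneg_right e6 hlam0.le
  linarith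

/-- A pair of vectors whose uniform approximation function is governed by a rapidly growing
sequence of best approximations, with prescribed limiting constant `c`. -/
theorem IsPlaneWeight.exists_pair {κ : ℝ} {ν : ℤ × ℤ → ℝ} (hν : IsPlaneWeight κ ν) {m : ℕ}
    (hm : 0 < m) {N : (Fin m → ℝ) → ℝ} (hN : IsNorm N) {s : ℝ} (hs : 2 ≤ s) :
    ∃ c₀ : ℝ, 0 < c₀ ∧ ∀ c, 0 ≤ c → c ≤ c₀ →
      ∃ (β : (Fin m → ℝ) × (Fin m → ℝ)) (y : ℕ → ℤ × ℤ),
        (∀ k : ℕ, (k : ℝ) + 1 ≤ ν (y (k + 1))) ∧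
        (∀ k : ℕ, ((k : ℝ) + 1) * ν (y k) ≤ ν (y (k + 1))) ∧
        (∀ k : ℕ, ∃ z, N (evalForm β (y k) z) * ν (y (k + 1)) ^ s < c + c₀ / (k + 1)) ∧
        (∀ k : ℕ, ∀ w ≠ 0, ν w < ν (y (k + 1)) →
          ∀ z, c < N (evalForm β w z) * ν (y (k + 1)) ^ s) ∧
        ∀ (h : ℚ) (l : (Fin m → ℚ) × (Fin m → ℚ)),
          (h : ℝ) + ∑ j, (l.1 j * β.1 j + l.2 j * β.2 j) = 0 → l = 0 := by
  obtain ⟨C, hC, hCN⟩ := hN.exists_mul_norm_le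
  have hκ := hν.1
  refine ⟨C * κ ^ 2 / 8, by positivity, fun c hc hcc => ?_⟩
  set c₀ := C * κ ^ 2 / 8 with hc₀
  have hc₀0 : 0 < c₀ := by positivity
  obtain ⟨e, he⟩ := exists_surjective_nat (ℚ × ((Fin m → ℚ) × (Fin m → ℚ)))
  let State := {S : ((Fin m → ℚ) × (Fin m → ℚ)) × (ℤ × ℤ) × ℝ //
    IsPrimitiveVector S.1 S.2.1 ∧ 0 < S.2.2}
  have step : ∀ (k : ℕ) (S : State), ∃ S' : State,
      Metric.closedBall (realPair S'.1.1) S'.1.2.2 ⊆ Metric.closedBall (realPair S.1.1) S.1.2.2 ∧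
      max ((k : ℝ) + 1) (((k : ℝ) + 1) * ν S.1.2.1) ≤ ν S'.1.2.1 ∧
      ∀ β ∈ Metric.closedBall (realPair S'.1.1) S'.1.2.2,
        (∃ z, N (evalForm β S.1.2.1 z) * ν S'.1.2.1 ^ s < c + c₀ / (k + 1)) ∧
        (∀ w ≠ 0, ν w < ν S'.1.2.1 → ∀ z, c < N (evalForm β w z) * ν S'.1.2.1 ^ s) ∧
        ((e k).2 ≠ 0 →
          ((e k).1 : ℝ) + ∑ j, ((e k).2.1 j * β.1 j + (e k).2.2 j * β.2 j) ≠ 0) := by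
    intro k S
    have hε : c₀ / (k + 1) ≤ c₀ := div_le_self hc₀0.le (by linarith [(Nat.cast_nonneg k : (0 : ℝ) ≤ k)])
    obtain ⟨P', y', r', h1, h2, h3, h4, h5⟩ := hν.exists_next hm hN hC hCN hs hc
      (ε := c₀ / (k + 1)) (by positivity) (by linarith) S.2.1 S.2.2
      (max ((k : ℝ) + 1) (((k : ℝ) + 1) * ν S.1.2.1)) (e k).1 (e k).2
    exact ⟨⟨(P', y', r'), h1, h2⟩, h3, h4, h5⟩
  choose f hf using step
  have init : IsPrimitiveVector (0 : (Fin m → ℚ) × (Fin m → ℚ)) (1, 0) := by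
    refine ⟨⟨0, fun j => by simp⟩, by simp, fun w _ hw => ⟨w.1, ?_⟩⟩
    simp [planeDet] at hw
    ext <;> simp [hw]
  let S₀ : State := ⟨(0, (1, 0), 1), init, one_pos⟩
  let S : ℕ → State := fun k => Nat.rec S₀ (fun k T => f k T) k
  have hS : ∀ k, S (k + 1) = f k (S k) := fun k => rfl
  obtain ⟨β, hβ⟩ := IsCompact.nonempty_iInter_of_sequence_nonempty_isCompact_isClosed
    (fun k => Metric.closedBall (realPair (S k).1.1) (S k).1.2.2)
    (fun k => by rw [hS]; exact (hf k (S k)).1)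
    (fun k => ⟨_, Metric.mem_closedBall_self (S k).2.2.le⟩)
    (isCompact_closedBall _ _) (fun k => Metric.isClosed_closedBall)
  rw [Set.mem_iInter] at hβ
  refine ⟨β, fun k => (S k).1.2.1, fun k => ?_, fun k => ?_, fun k => ?_, fun k => ?_, ?_⟩
  · exact (le_max_left _ _).trans (hf k (S k)).2.1
  · exact (le_max_right _ _).trans (hf k (S k)).2.1
  · exact ((hf k (S k)).2.2 β (hβ (k + 1))).1
  · exact ((hf k (S k)).2.2 β (hβ (k + 1))).2.1
  · intro h l hl
    obtain ⟨k, hk⟩ := he (h, l)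
    by_contra hne
    have := ((hf k (S k)).2.2 β (hβ (k + 1))).2.2
    rw [hk] at this
    exact this hne hl

lemma volume_near_int_le (lo W s δ : ℝ) (hW : 0 ≤ W) (hδ : 0 < δ) :
    volume {b : ℝ | lo ≤ b ∧ b ≤ lo + W ∧ ∃ z : ℤ, |b + s + z| < δ} ≤
      ENNReal.ofReal ((W + 2 * δ + 1) * (2 * δ)) := by
  set F := Finset.Icc ⌈-(lo + W) - s - δ⌉ ⌊-lo - s + δ⌋ with hF
  have hsub : {b : ℝ | lo ≤ b ∧ b ≤ lo + W ∧ ∃ z : ℤ, |b + s + z| < δ} ⊆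
      ⋃ z ∈ F, Set.Ioo (-s - z - δ) (-s - (z : ℝ) + δ) := by
    rintro b ⟨h1, h2, z, hz⟩
    rw [abs_lt] at hz
    simp only [Set.mem_iUnion, hF, Finset.mem_Icc, Int.ceil_le, Int.le_floor, Set.mem_Ioo]
    exact ⟨z, ⟨by linarith, by linarith⟩, by linarith, by linarith⟩
  have hcard : (F.card : ℝ) ≤ W + 2 * δ + 1 := by
    have h1 := Int.le_ceil (-(lo + W) - s - δ)
    have h2 := Int.floor_le (-lo - s + δ)
    rw [hF, Int.card_Icc]
    have h3 : (((⌊-lo - s + δ⌋ + 1 - ⌈-(lo + W) - s - δ⌉).toNat : ℤ) : ℝ) ≤ W + 2 * δ + 1 := by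
      rw [Int.toNat_eq_max, Int.cast_max]
      push_cast
      exact max_le (by linarith) (by linarith)
    exact_mod_cast h3
  calc volume {b : ℝ | lo ≤ b ∧ b ≤ lo + W ∧ ∃ z : ℤ, |b + s + z| < δ}
      ≤ ∑ z ∈ F, volume (Set.Ioo (-s - z - δ) (-s - (z : ℝ) + δ)) :=
        (measure_mono hsub).trans (measure_biUnion_finset_le _ _)
    _ = ENNReal.ofReal (F.card * (2 * δ)) := by
        rw [Finset.sum_congr rfl fun z _ => by
          rw [Real.volume_Ioo, show -s - (z : ℝ) + δ - (-s - z - δ) = 2 * δ by ring]]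
        rw [Finset.sum_const, nsmul_eq_mul, ENNReal.ofReal_mul (Nat.cast_nonneg _),
          ENNReal.ofReal_natCast]
    _ ≤ _ := ENNReal.ofReal_le_ofReal (by gcongr)

lemma volume_strip_le {l : ℕ} {x : Fin l → ℤ} (hx : x ≠ 0) (lo : Fin l → ℝ) (s : ℝ) {δ : ℝ}
    (hδ : 0 < δ) (hδ1 : δ ≤ 1) :
    volume {a : Fin l → ℝ | (∀ i, lo i ≤ a i ∧ a i ≤ lo i + 1) ∧
      ∃ z : ℤ, |∑ i, a i * x i + s + z| < δ} ≤ ENNReal.ofReal (2 * (l + 3) * δ) := by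
  obtain ⟨i₁, hi₁⟩ := Function.ne_iff.1 hx
  have : Nonempty (Fin l) := ⟨i₁⟩
  obtain ⟨i₀, hi₀⟩ := Finite.exists_max fun i => |x i|
  have hX : (1 : ℝ) ≤ |(x i₀ : ℝ)| := by
    have h1 : 1 ≤ |x i₀| := (Int.one_le_abs hi₁).trans (hi₀ i₁)
    exact_mod_cast h1
  have hx0 : (x i₀ : ℝ) ≠ 0 := by
    intro h
    rw [h] at hX
    norm_num at hX
  set W : ℝ := ∑ i, |(x i : ℝ)| with hW
  set Lo : ℝ := ∑ i, min (lo i * x i) ((lo i + 1) * x i) with hLo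
  have hW0 : 0 ≤ W := Finset.sum_nonneg fun i _ => abs_nonneg _
  have hWX : W ≤ l * |(x i₀ : ℝ)| := by
    calc W ≤ ∑ _i : Fin l, |(x i₀ : ℝ)| :=
          Finset.sum_le_sum fun i _ => by exact_mod_cast hi₀ i
      _ = _ := by simp
  set J := {b : ℝ | Lo ≤ b ∧ b ≤ Lo + W ∧ ∃ z : ℤ, |b + s + z| < δ} with hJ
  set M : Matrix (Fin l) (Fin l) ℝ := Matrix.updateRow 1 i₀ (fun i => (x i : ℝ)) with hM
  have hdet : LinearMap.det (Matrix.toLin' M) = x i₀ := by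
    rw [LinearMap.det_toLin', hM]
    have := Matrix.cramer_transpose_apply (1 : Matrix (Fin l) (Fin l) ℝ) (fun i => (x i : ℝ)) i₀
    rw [← this]
    simp
  have hMv : ∀ a : Fin l → ℝ, Matrix.toLin' M a = Function.update a i₀ (∑ i, a i * x i) := by
    intro a
    ext i
    rw [Matrix.toLin'_apply, Matrix.mulVec]
    by_cases h : i = i₀
    · subst h
      simp [hM, dotProduct, mul_comm]
    · simp [hM, h, Matrix.one_apply, dotProduct]
  set S : Set (Fin l → ℝ) :=
    Set.pi Set.univ (Function.update (fun i => Set.Icc (lo i) (lo i + 1)) i₀ J) with hS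
  have hsub : {a : Fin l → ℝ | (∀ i, lo i ≤ a i ∧ a i ≤ lo i + 1) ∧
      ∃ z : ℤ, |∑ i, a i * x i + s + z| < δ} ⊆ Matrix.toLin' M ⁻¹' S := by
    rintro a ⟨ha, hz⟩
    rw [Set.mem_preimage, hMv, hS, Set.mem_univ_pi]
    intro i
    by_cases h : i = i₀
    · subst h
      simp only [Function.update_self]
      refine ⟨?_, ?_, hz⟩
      · refine Finset.sum_le_sum fun i _ => ?_
        rcases le_total 0 (x i : ℝ) with h | h
        · exact (min_le_left _ _).trans (mul_le_mul_of_nonneg_right (ha i).1 h)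
        · exact (min_le_right _ _).trans (mul_le_mul_of_nonpos_right (ha i).2 h)
      · rw [hLo, hW, ← Finset.sum_add_distrib]
        refine Finset.sum_le_sum fun i _ => ?_
        rcases le_total 0 (x i : ℝ) with h | h
        · rw [abs_of_nonneg h, min_eq_left (by nlinarith)]
          nlinarith [mul_le_mul_of_nonneg_right (ha i).2 h]
        · rw [abs_of_nonpos h, min_eq_right (by nlinarith)]
          nlinarith [mul_le_mul_of_nonpos_right (ha i).1 h]
    · simpa [Function.update_of_ne h] using ha i
  have hvolS : volume S = volume J := by
    rw [hS, volume_pi_pi, Finset.prod_eq_single i₀]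
    · simp
    · intro i _ hi
      simp [Function.update_of_ne hi]
    · simp
  calc _ ≤ volume (Matrix.toLin' M ⁻¹' S) := measure_mono hsub
    _ = ENNReal.ofReal |(x i₀ : ℝ)⁻¹| * volume J := by
        rw [Measure.addHaar_preimage_linearMap _ (by rw [hdet]; exact hx0), hdet, hvolS]
    _ ≤ ENNReal.ofReal |(x i₀ : ℝ)⁻¹| * ENNReal.ofReal ((W + 2 * δ + 1) * (2 * δ)) := by
        gcongr
        exact volume_near_int_le Lo W s δ hW0 hδ
    _ = ENNReal.ofReal (|(x i₀ : ℝ)|⁻¹ * ((W + 2 * δ + 1) * (2 * δ))) := by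
        rw [← ENNReal.ofReal_mul (abs_nonneg _), abs_inv]
    _ ≤ ENNReal.ofReal (2 * (l + 3) * δ) := by
        refine ENNReal.ofReal_le_ofReal ?_
        rw [inv_mul_le_iff₀ (by linarith)]
        have : W + 2 * δ + 1 ≤ |(x i₀ : ℝ)| * (l + 3) := by nlinarith
        nlinarith

/-- The unit box with lower corner `lo`. -/
def unitBox {m l : ℕ} (lo : Fin m → Fin l → ℝ) : Set (Fin m → Fin l → ℝ) :=
  {A | ∀ j i, lo j i ≤ A j i ∧ A j i ≤ lo j i + 1}

lemma volume_unitBox {m l : ℕ} (lo : Fin m → Fin l → ℝ) : volume (unitBox lo) = 1 := by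
  have : unitBox lo =
      Set.pi Set.univ fun j => Set.pi Set.univ fun i => Set.Icc (lo j i) (lo j i + 1) := by
    ext A
    simp only [unitBox, Set.mem_univ_pi]
    rfl
  rw [this, volume_pi_pi]
  refine Finset.prod_eq_one fun j _ => ?_
  rw [volume_pi_pi]
  simp

lemma volume_unitBox_inter_strips_le {m l : ℕ} (lo : Fin m → Fin l → ℝ) {x : Fin l → ℤ}
    (hx : x ≠ 0) (s : Fin m → ℝ) {δ : ℝ} (hδ : 0 < δ) (hδ1 : δ ≤ 1) :
    volume {A : Fin m → Fin l → ℝ | A ∈ unitBox lo ∧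
      ∃ z : Fin m → ℤ, ∀ j, |∑ i, A j i * x i + s j + z j| < δ} ≤
      ENNReal.ofReal ((2 * (l + 3) * δ) ^ m) := by
  have hsub : {A : Fin m → Fin l → ℝ | A ∈ unitBox lo ∧
      ∃ z : Fin m → ℤ, ∀ j, |∑ i, A j i * x i + s j + z j| < δ} ⊆
      Set.pi Set.univ fun j => {a : Fin l → ℝ | (∀ i, lo j i ≤ a i ∧ a i ≤ lo j i + 1) ∧
        ∃ z : ℤ, |∑ i, a i * x i + s j + z| < δ} := by
    rintro A ⟨hA, z, hz⟩
    rw [Set.mem_univ_pi]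
    exact fun j => ⟨hA j, z j, hz j⟩
  refine (measure_mono hsub).trans ?_
  rw [volume_pi_pi, ENNReal.ofReal_pow (by positivity)]
  refine (Finset.prod_le_prod' fun j _ => volume_strip_le hx (lo j) (s j) hδ hδ1).trans ?_
  simp

/-- The matrix with first two columns `β.1`, `β.2`, followed by the columns of `A`. -/
def glue {m l : ℕ} (β : (Fin m → ℝ) × (Fin m → ℝ)) (A : Fin m → Fin l → ℝ) :
    Fin m → Fin (l + 2) → ℝ :=
  fun j => Fin.cons (β.1 j) (Fin.cons (β.2 j) (A j))

lemma sum_glue_mul {m l : ℕ} (β : (Fin m → ℝ) × (Fin m → ℝ)) (A : Fin m → Fin l → ℝ)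
    (j : Fin m) (b : Fin (l + 2) → ℝ) :
    ∑ i, glue β A j i * b i =
      ∑ i, A j i * b i.succ.succ + (b 0 * β.1 j + b 1 * β.2 j) := by
  rw [Fin.sum_univ_succ, Fin.sum_univ_succ]
  simp only [glue, Fin.cons_zero, Fin.cons_succ]
  rw [Fin.succ_zero_eq_one]
  ring

/-- The matrices in a unit box for which an integer vector outside the plane of the first two
coordinates, of size at most `T`, gives an approximation better than `η`. -/
def interferenceSet {m l : ℕ} (N1 : (Fin (l + 2) → ℝ) → ℝ) (N2 : (Fin m → ℝ) → ℝ)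
    (lo : Fin m → Fin l → ℝ) (β : (Fin m → ℝ) × (Fin m → ℝ)) (T η : ℝ) :
    Set (Fin m → Fin l → ℝ) :=
  {A | A ∈ unitBox lo ∧ ∃ (b : Fin (l + 2) → ℤ) (z : Fin m → ℤ),
    (fun i : Fin l => b i.succ.succ) ≠ 0 ∧ N1 (fun i => (b i : ℝ)) ≤ T ∧
    N2 (fun j => (∑ i, glue β A j i * (b i : ℝ)) + (z j : ℝ)) < η}

lemma exists_volume_interferenceSet_le {m l : ℕ} {N1 : (Fin (l + 2) → ℝ) → ℝ}
    {N2 : (Fin m → ℝ) → ℝ} (hN1 : IsNorm N1) (hN2 : IsNorm N2) :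
    ∃ K C : ℝ, 0 < K ∧ 0 < C ∧ ∀ (lo : Fin m → Fin l → ℝ) (β : (Fin m → ℝ) × (Fin m → ℝ))
      (T η : ℝ), 1 ≤ T → 0 < η → η ≤ C →
      volume (interferenceSet N1 N2 lo β T η) ≤ ENNReal.ofReal (K * (T ^ (l + 2) * η ^ m)) := by
  obtain ⟨C₁, hC₁, h1⟩ := hN1.exists_mul_norm_le
  obtain ⟨C, hC, h2⟩ := hN2.exists_mul_norm_le
  refine ⟨(2 / C₁ + 1) ^ (l + 2) * (2 * (l + 3) / C) ^ m, C, by positivity, hC,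
    fun lo β T η hT hη hηC => ?_⟩
  set F : Finset (Fin (l + 2) → ℤ) :=
    (Fintype.piFinset fun _ => Finset.Icc (-⌊T / C₁⌋) ⌊T / C₁⌋).filter
      (fun b => (fun i : Fin l => b i.succ.succ) ≠ 0) with hF
  have hfl : 0 ≤ ⌊T / C₁⌋ := Int.floor_nonneg.2 (by positivity)
  have hcard : (F.card : ℝ) ≤ ((2 / C₁ + 1) * T) ^ (l + 2) := by
    have e1 : F.card ≤ (2 * ⌊T / C₁⌋ + 1).toNat ^ (l + 2) := by
      refine (Finset.card_filter_le _ _).trans ?_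
      rw [Fintype.card_piFinset]
      simp only [Int.card_Icc, Finset.prod_const, Finset.card_univ, Fintype.card_fin]
      rw [show ⌊T / C₁⌋ + 1 - -⌊T / C₁⌋ = 2 * ⌊T / C₁⌋ + 1 by ring]
    have e2 : (((2 * ⌊T / C₁⌋ + 1).toNat : ℕ) : ℝ) ≤ (2 / C₁ + 1) * T := by
      have e3 : (((2 * ⌊T / C₁⌋ + 1).toNat : ℤ) : ℝ) = 2 * (⌊T / C₁⌋ : ℝ) + 1 := by
        rw [Int.toNat_of_nonneg (by positivity)]
        push_cast
        rfl
      have e4 := Int.floor_le (T / C₁)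
      have e5 : (((2 * ⌊T / C₁⌋ + 1).toNat : ℕ) : ℝ) = 2 * (⌊T / C₁⌋ : ℝ) + 1 := by
        exact_mod_cast e3
      rw [e5, add_mul, div_mul_eq_mul_div, mul_div_assoc]
      linarith
    calc (F.card : ℝ) ≤ (((2 * ⌊T / C₁⌋ + 1).toNat : ℕ) : ℝ) ^ (l + 2) := by exact_mod_cast e1
      _ ≤ _ := by gcongr
  have hsub : interferenceSet N1 N2 lo β T η ⊆ ⋃ b ∈ F, {A : Fin m → Fin l → ℝ | A ∈ unitBox lo ∧
      ∃ z : Fin m → ℤ, ∀ j, |∑ i : Fin l, A j i * ((b i.succ.succ : ℤ) : ℝ) +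
        ((b 0 : ℝ) * β.1 j + (b 1 : ℝ) * β.2 j) + z j| < η / C} := by
    rintro A ⟨hA, b, z, hb, hbT, hη'⟩
    simp only [Set.mem_iUnion]
    refine ⟨b, ?_, hA, z, fun j => ?_⟩
    · rw [hF, Finset.mem_filter]
      refine ⟨?_, hb⟩
      rw [Fintype.mem_piFinset]
      intro i
      have e1 := (h1 _).trans hbT
      rw [← le_div_iff₀' hC₁] at e1
      have e2 := (norm_le_pi_norm (fun i => (b i : ℝ)) i).trans e1
      rw [Real.norm_eq_abs] at e2
      have e3 : |b i| ≤ ⌊T / C₁⌋ := Int.le_floor.2 (by exact_mod_cast e2)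
      exact Finset.mem_Icc.2 (abs_le.1 e3)
    · have e1 := (h2 _).trans_lt hη'
      rw [← lt_div_iff₀' hC] at e1
      have e2 := (norm_le_pi_norm _ j).trans_lt e1
      rw [Real.norm_eq_abs, sum_glue_mul β A j fun i => (b i : ℝ)] at e2
      exact e2
  have hδ : 0 < η / C := by positivity
  have hδ1 : η / C ≤ 1 := (div_le_one hC).2 hηC
  calc volume (interferenceSet N1 N2 lo β T η)
      ≤ ∑ b ∈ F, ENNReal.ofReal ((2 * (l + 3) * (η / C)) ^ m) := by
        refine (measure_mono hsub).trans ((measure_biUnion_finset_le _ _).trans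
          (Finset.sum_le_sum fun b hb => ?_))
        exact volume_unitBox_inter_strips_le lo (Finset.mem_filter.1 hb).2 _ hδ hδ1
    _ = ENNReal.ofReal (F.card * (2 * (l + 3) * (η / C)) ^ m) := by
        rw [Finset.sum_const, nsmul_eq_mul, ENNReal.ofReal_mul (Nat.cast_nonneg _),
          ENNReal.ofReal_natCast]
    _ ≤ ENNReal.ofReal (((2 / C₁ + 1) * T) ^ (l + 2) * (2 * (l + 3) * (η / C)) ^ m) :=
        ENNReal.ofReal_le_ofReal (by gcongr)
    _ = _ := by
        congr 1
        rw [mul_pow, show 2 * ((l : ℝ) + 3) * (η / C) = 2 * (l + 3) / C * η by ring, mul_pow]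
        ring

/-- For small `c`, interference occurs for all large indices only on a set of measure at most
one half. -/
lemma exists_volume_eventually_interferenceSet_le {m l : ℕ} (hm : 0 < m)
    {N1 : (Fin (l + 2) → ℝ) → ℝ} {N2 : (Fin m → ℝ) → ℝ} (hN1 : IsNorm N1) (hN2 : IsNorm N2) :
    ∃ c₁ : ℝ, 0 < c₁ ∧ ∀ c, 0 < c → c ≤ c₁ →
      ∀ (lo : Fin m → Fin l → ℝ) (β : (Fin m → ℝ) × (Fin m → ℝ)) (T : ℕ → ℝ), (∀ k, 1 ≤ T k) →
      volume {A | ∀ᶠ k in atTop, A ∈ interferenceSet N1 N2 lo β (T k)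
        (c / T k ^ (((l + 2 : ℕ) : ℝ) / m))} ≤ 2⁻¹ := by
  obtain ⟨K, C, hK, hC, h⟩ := exists_volume_interferenceSet_le (m := m) hN1 hN2
  refine ⟨min C (min 1 (1 / (2 * K))), by positivity, fun c hc hcc lo β T hT => ?_⟩
  simp only [le_min_iff] at hcc
  obtain ⟨hcC, hc1, hcK⟩ := hcc
  set s : ℝ := ((l + 2 : ℕ) : ℝ) / m with hs
  have hs0 : 0 ≤ s := by positivity
  have hbad : ∀ k, volume (interferenceSet N1 N2 lo β (T k) (c / T k ^ s)) ≤ 2⁻¹ := by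
    intro k
    have hTk : 0 < T k := by linarith [hT k]
    have hTs : 1 ≤ T k ^ s := Real.one_le_rpow (hT k) hs0
    refine (h lo β (T k) _ (hT k) (by positivity) ((div_le_self hc.le hTs).trans hcC)).trans ?_
    have e1 : (T k ^ s) ^ m = T k ^ (l + 2) := by
      rw [← Real.rpow_natCast, ← Real.rpow_mul hTk.le, hs, div_mul_cancel₀, Real.rpow_natCast]
      exact_mod_cast hm.ne'
    have e2 : K * (T k ^ (l + 2) * (c / T k ^ s) ^ m) ≤ 1 / 2 := by
      rw [div_pow, e1, mul_div_cancel₀ _ (by positivity)]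
      have e3 : c ^ m ≤ c := pow_le_of_le_one hc.le hc1 hm.ne'
      rw [le_div_iff₀ (by positivity)] at hcK
      nlinarith
    refine (ENNReal.ofReal_le_ofReal e2).trans ?_
    rw [one_div, ENNReal.ofReal_inv_of_pos two_pos]
    simp
  have hmono : Monotone fun n : ℕ =>
      {A | ∀ k ≥ n, A ∈ interferenceSet N1 N2 lo β (T k) (c / T k ^ s)} :=
    fun a b hab A hA k hk => hA k (hab.trans hk)
  have heq : {A | ∀ᶠ k in atTop, A ∈ interferenceSet N1 N2 lo β (T k) (c / T k ^ s)} =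
      ⋃ n : ℕ, {A | ∀ k ≥ n, A ∈ interferenceSet N1 N2 lo β (T k) (c / T k ^ s)} := by
    ext A
    simp [eventually_atTop]
  rw [heq, hmono.measure_iUnion]
  refine iSup_le fun n => le_trans (measure_mono ?_) (hbad n)
  intro A hA
  exact hA n le_rfl

section Psi

variable {m n : ℕ} {N1 : (Fin n → ℝ) → ℝ} {N2 : (Fin m → ℝ) → ℝ} {Ω : Fin m → Fin n → ℝ} {t : ℝ}

lemma psiGen_nonneg (hN2 : IsNorm N2) : 0 ≤ psiGen m n N1 N2 Ω t := by
  refine Real.sInf_nonneg ?_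
  rintro r ⟨b, z, -, -, rfl⟩
  exact hN2.nonneg _

lemma psiGen_le (hN2 : IsNorm N2) (b : Fin n → ℤ) (z : Fin m → ℤ)
    (h1 : 1 ≤ N1 (fun i => (b i : ℝ))) (h2 : N1 (fun i => (b i : ℝ)) ≤ t) :
    psiGen m n N1 N2 Ω t ≤ N2 (fun j => (∑ i, Ω j i * (b i : ℝ)) + (z j : ℝ)) := by
  refine csInf_le ⟨0, ?_⟩ ⟨b, z, h1, h2, rfl⟩
  rintro r ⟨b, z, -, -, rfl⟩
  exact hN2.nonneg _

lemma le_psiGen {η : ℝ} (b₀ : Fin n → ℤ) (h1 : 1 ≤ N1 (fun i => (b₀ i : ℝ)))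
    (h2 : N1 (fun i => (b₀ i : ℝ)) ≤ t)
    (h : ∀ (b : Fin n → ℤ) (z : Fin m → ℤ), 1 ≤ N1 (fun i => (b i : ℝ)) →
      N1 (fun i => (b i : ℝ)) ≤ t →
      η ≤ N2 (fun j => (∑ i, Ω j i * (b i : ℝ)) + (z j : ℝ))) :
    η ≤ psiGen m n N1 N2 Ω t := by
  refine le_csInf ⟨_, b₀, 0, h1, h2, rfl⟩ ?_
  rintro r ⟨b, z, h1, h2, rfl⟩
  exact h b z h1 h2

/-- Criterion for the value of `Θ` and for singularity along a sequence of scales `T k` at which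
`ψ` jumps. -/
lemma thetaGen_eq_of_scales (hN2 : IsNorm N2) {c C : ℝ} (hc : 0 ≤ c) (hC : 0 ≤ C) {T : ℕ → ℝ}
    (hT : ∀ k : ℕ, (k : ℝ) + 1 ≤ T (k + 1)) (hTT : ∀ k : ℕ, ((k : ℝ) + 1) * T k ≤ T (k + 1))
    (hn : 0 < (n : ℝ) / m)
    (hup : ∀ k : ℕ, 1 ≤ k → ∀ t, T k ≤ t →
      psiGen m n N1 N2 Ω t * T (k + 1) ^ ((n : ℝ) / m) ≤ c + C / (k + 1))
    (hlow : 0 < c → ∃ᶠ k in atTop, ∀ t, T k ≤ t → t < T (k + 1) →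
      c ≤ psiGen m n N1 N2 Ω t * T (k + 1) ^ ((n : ℝ) / m)) :
    ThetaGen m n N1 N2 Ω = c ∧ ThetaTildeGen m n N1 N2 Ω ≤ 0 := by
  set s : ℝ := (n : ℝ) / m with hs
  set f : ℝ → ℝ := fun t => t ^ s * psiGen m n N1 N2 Ω t with hf
  have hTpos : ∀ k, 0 < T (k + 1) := fun k => (Nat.cast_add_one_pos k).trans_le (hT k)
  have hf0 : ∀ᶠ t in atTop, 0 ≤ f t := by
    filter_upwards [eventually_ge_atTop 0] with t ht
    exact mul_nonneg (Real.rpow_nonneg ht _) (psiGen_nonneg hN2)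
  have hTtop : Tendsto (fun k => T (k + 1)) atTop atTop :=
    tendsto_atTop_mono hT (tendsto_atTop_add_const_right _ _ tendsto_natCast_atTop_atTop)
  have hupper : ∀ ε, 0 < ε → ∀ᶠ t in atTop, f t ≤ c + ε := by
    intro ε hε
    obtain ⟨K, hK⟩ := exists_nat_gt (C / ε)
    have hev : ∀ᶠ t in atTop, ∀ j ∈ Finset.range (K + 1), T (j + 1) ≤ t :=
      (Filter.eventually_all_finset _).2 fun j _ => eventually_ge_atTop _
    filter_upwards [hev, eventually_ge_atTop 0] with t ht ht0
    have hex : ∃ k, t < T (k + 1) := (hTtop.eventually_gt_atTop t).exists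
    classical
    have h1 := Nat.find_spec hex
    set k := Nat.find hex with hk
    have hKk : K + 1 ≤ k := by
      rw [hk, Nat.le_find_iff]
      intro j hj
      exact not_lt.2 (ht j (Finset.mem_range.2 hj))
    have h2 : T k ≤ t := by
      have h3 := Nat.find_min hex (m := k - 1) (by omega)
      rwa [not_lt, Nat.sub_add_cancel (by omega)] at h3
    have h4 := hup k (by omega) t h2
    have h5 : C / (k + 1) ≤ ε := by
      rw [div_lt_iff₀ hε] at hK
      rw [div_le_iff₀ (by positivity)]
      have : (K : ℝ) + 1 ≤ k := by exact_mod_cast hKk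
      nlinarith
    calc f t = psiGen m n N1 N2 Ω t * t ^ s := mul_comm _ _
      _ ≤ psiGen m n N1 N2 Ω t * T (k + 1) ^ s :=
        mul_le_mul_of_nonneg_left (Real.rpow_le_rpow ht0 h1.le hn.le) (psiGen_nonneg hN2)
      _ ≤ c + ε := by linarith
  have hbdd : IsBoundedUnder (· ≤ ·) atTop f := ⟨c + 1, hupper 1 one_pos⟩
  have hbdd' : IsBoundedUnder (· ≥ ·) atTop f := ⟨0, hf0⟩
  refine ⟨le_antisymm ?_ ?_, ?_⟩
  · exact le_of_forall_pos_le_add fun ε hε =>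
      limsup_le_of_le hbdd'.isCoboundedUnder_le (hupper ε hε)
  · rcases hc.eq_or_lt with rfl | hc0
    · exact le_limsup_of_frequently_le hf0.frequently hbdd
    refine le_of_forall_lt fun a ha => ?_
    have hratio : Tendsto (fun k : ℕ => ((k : ℝ) / (k + 1)) ^ s * c) atTop (nhds c) := by
      have h1 := (tendsto_natCast_div_add_atTop (1 : ℝ)).rpow_const (p := s) (Or.inr hn.le)
      simpa using h1.mul_const c
    obtain ⟨b, hab, hbc⟩ := exists_between ha
    refine hab.trans_le (le_limsup_of_frequently_le ?_ hbdd)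
    have htop : Tendsto (fun k : ℕ => (k : ℝ) / (k + 1) * T (k + 1)) atTop atTop := by
      refine tendsto_atTop_mono (fun k => ?_) tendsto_natCast_atTop_atTop
      rw [div_mul_eq_mul_div, le_div_iff₀ (by positivity)]
      exact mul_le_mul_of_nonneg_left (hT k) (Nat.cast_nonneg k)
    refine htop.frequently (((hlow hc0).and_eventually
      ((hratio.eventually_const_lt hbc).and (eventually_ge_atTop 1))).mono ?_)
    rintro k ⟨h1, h2, h3⟩
    obtain ⟨i, rfl⟩ : ∃ i, k = i + 1 := ⟨k - 1, by omega⟩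
    have hk1 : (1 : ℝ) ≤ ((i + 1 : ℕ) : ℝ) := by exact_mod_cast h3
    have hT1 := hTpos (i + 1)
    have h4 := h1 (((i + 1 : ℕ) : ℝ) / (((i + 1 : ℕ) : ℝ) + 1) * T (i + 1 + 1)) (by
      rw [div_mul_eq_mul_div, le_div_iff₀ (by positivity)]
      have := hTT (i + 1)
      have := hTpos i
      nlinarith) (by
      rw [div_mul_eq_mul_div, div_lt_iff₀ (by positivity)]
      nlinarith)
    have h5 : (0 : ℝ) ≤ (((i + 1 : ℕ) : ℝ) / (((i + 1 : ℕ) : ℝ) + 1)) ^ s := by positivity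
    rw [Real.mul_rpow (by positivity) hT1.le]
    nlinarith [mul_le_mul_of_nonneg_left h4 h5]
  · refine le_of_forall_pos_le_add fun ε hε => ?_
    rw [zero_add]
    refine liminf_le_of_frequently_le ?_ hbdd'
    have hzero : Tendsto (fun k : ℕ => ((1 : ℝ) / (k + 1)) ^ s * (c + C)) atTop (nhds 0) := by
      have h1 := (tendsto_one_div_add_atTop_nhds_zero_nat (𝕜 := ℝ)).rpow_const (p := s)
        (Or.inr hn.le)
      rw [Real.zero_rpow hn.ne'] at h1
      simpa using h1.mul_const (c + C)
    refine hTtop.frequently (Eventually.frequently ?_)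
    have hzero' := (hzero.comp (tendsto_add_atTop_nat 1)).eventually_lt_const hε
    filter_upwards [hzero'] with k hk
    refine le_trans ?_ hk.le
    have h1 := hup (k + 1) (by omega) _ le_rfl
    have h2 := hTT (k + 1)
    have h3 := hTpos k
    have h4 := hTpos (k + 1)
    have h5 : C / (((k + 1 : ℕ) : ℝ) + 1) ≤ C := div_le_self hC (by
      have : (0 : ℝ) ≤ ((k + 1 : ℕ) : ℝ) := Nat.cast_nonneg _
      linarith)
    have h6 : T (k + 1) ^ s ≤ (1 / (((k + 1 : ℕ) : ℝ) + 1)) ^ s * T (k + 1 + 1) ^ s := by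
      rw [← Real.mul_rpow (by positivity) h4.le]
      refine Real.rpow_le_rpow h3.le ?_ hn.le
      rw [div_mul_eq_mul_div, one_mul, le_div_iff₀ (by positivity)]
      linarith
    have h7 : (0 : ℝ) ≤ (1 / (((k + 1 : ℕ) : ℝ) + 1)) ^ s := by positivity
    have h8 : 0 ≤ psiGen m n N1 N2 Ω (T (k + 1)) := psiGen_nonneg hN2
    calc f (T (k + 1)) ≤ (1 / (((k + 1 : ℕ) : ℝ) + 1)) ^ s * T (k + 1 + 1) ^ s *
          psiGen m n N1 N2 Ω (T (k + 1)) := mul_le_mul_of_nonneg_right h6 h8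
      _ = (1 / (((k + 1 : ℕ) : ℝ) + 1)) ^ s *
          (psiGen m n N1 N2 Ω (T (k + 1)) * T (k + 1 + 1) ^ s) := by ring
      _ ≤ _ := mul_le_mul_of_nonneg_left (by linarith) h7

end Psi

/-- The integer vector `(w.1, w.2, 0, …, 0)`. -/
def planeVec (l : ℕ) (w : ℤ × ℤ) : Fin (l + 2) → ℤ := Fin.cons w.1 (Fin.cons w.2 0)

section PlaneVec

variable {m l : ℕ} {N1 : (Fin (l + 2) → ℝ) → ℝ} {N2 : (Fin m → ℝ) → ℝ}

@[simp] lemma planeVec_zero (w : ℤ × ℤ) : planeVec l w 0 = w.1 := rfl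

@[simp] lemma planeVec_one (w : ℤ × ℤ) : planeVec l w 1 = w.2 := rfl

@[simp] lemma planeVec_succ_succ (w : ℤ × ℤ) (i : Fin l) : planeVec l w i.succ.succ = 0 := rfl

lemma eq_planeVec {b : Fin (l + 2) → ℤ} (hb : (fun i : Fin l => b i.succ.succ) = 0) :
    b = planeVec l (b 0, b 1) := by
  ext i
  refine Fin.cases rfl (fun i => ?_) i
  refine Fin.cases rfl (fun i => ?_) i
  exact congrFun hb i

lemma exists_isPlaneWeight (hN1 : IsNorm N1) :
    ∃ κ, IsPlaneWeight κ fun w => N1 fun i => (planeVec l w i : ℝ) := by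
  obtain ⟨κ, hκ, h⟩ := hN1.exists_mul_norm_le
  refine ⟨κ, hκ, fun w => ?_, fun k w => ?_⟩
  · have h0 : ∀ i, κ * |(planeVec l w i : ℝ)| ≤ N1 fun i => (planeVec l w i : ℝ) := fun i =>
      (mul_le_mul_of_nonneg_left (norm_le_pi_norm (fun i => (planeVec l w i : ℝ)) i) hκ.le).trans
        (h _)
    exact ⟨h0 0, h0 1⟩
  · beta_reduce
    rw [← hN1.2.1]
    congr 1
    ext i
    refine Fin.cases ?_ (fun i => Fin.cases ?_ (fun i => ?_) i) i
    · simp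
    · rw [Fin.succ_zero_eq_one]
      simp
    · simp

lemma glue_planeVec (β : (Fin m → ℝ) × (Fin m → ℝ)) (A : Fin m → Fin l → ℝ) (w : ℤ × ℤ)
    (z : Fin m → ℤ) :
    (fun j => (∑ i, glue β A j i * (planeVec l w i : ℝ)) + (z j : ℝ)) = evalForm β w z := by
  ext j
  rw [sum_glue_mul β A j fun i => (planeVec l w i : ℝ)]
  simp [evalForm]

/-- If `β` is governed by the scales `T k` and `A` avoids interference infinitely often, then the
glued matrix is singular with `Θ` equal to `c`. -/
lemma thetaGen_glue (hm : 0 < m) (hN1 : IsNorm N1) (hN2 : IsNorm N2) {c c₀ : ℝ} (hc : 0 ≤ c) (hc₀ : 0 ≤ c₀)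
    {β : (Fin m → ℝ) × (Fin m → ℝ)} {lo A : Fin m → Fin l → ℝ} (hA : A ∈ unitBox lo)
    {y : ℕ → ℤ × ℤ} {T : ℕ → ℝ} (hy : ∀ k, T k = N1 fun i => (planeVec l (y k) i : ℝ))
    (h1 : ∀ k : ℕ, (k : ℝ) + 1 ≤ T (k + 1)) (h2 : ∀ k : ℕ, ((k : ℝ) + 1) * T k ≤ T (k + 1))
    (h3 : ∀ k : ℕ, ∃ z, N2 (evalForm β (y k) z) * T (k + 1) ^ (((l + 2 : ℕ) : ℝ) / m) <
      c + c₀ / (k + 1))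
    (h4 : ∀ k : ℕ, ∀ w : ℤ × ℤ, w ≠ 0 → (N1 fun i => (planeVec l w i : ℝ)) < T (k + 1) →
      ∀ z, c < N2 (evalForm β w z) * T (k + 1) ^ (((l + 2 : ℕ) : ℝ) / m))
    (h5 : 0 < c → ∃ᶠ k in atTop, A ∉ interferenceSet N1 N2 lo β (T (k + 1))
      (c / T (k + 1) ^ (((l + 2 : ℕ) : ℝ) / m))) :
    ThetaGen m (l + 2) N1 N2 (glue β A) = c ∧ ThetaTildeGen m (l + 2) N1 N2 (glue β A) ≤ 0 := by
  have hT1 : ∀ k : ℕ, 1 ≤ k → 1 ≤ T k := by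
    intro k hk
    obtain ⟨i, rfl⟩ : ∃ i, k = i + 1 := ⟨k - 1, by omega⟩
    have := h1 i
    have : (0 : ℝ) ≤ i := Nat.cast_nonneg i
    linarith
  have hTs : ∀ k : ℕ, 0 < T (k + 1) ^ (((l + 2 : ℕ) : ℝ) / m) := fun k =>
    Real.rpow_pos_of_pos (one_pos.trans_le (hT1 _ (by omega))) _
  refine thetaGen_eq_of_scales hN2 hc hc₀ h1 h2 (by positivity) (fun k hk t ht => ?_) fun hc0 => ?_
  · obtain ⟨z, hz⟩ := h3 k
    rw [← glue_planeVec β A] at hz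
    have h6 := psiGen_le hN2 (Ω := glue β A) (t := t) (planeVec l (y k)) z
      ((hT1 k hk).trans_eq (hy k)) ((hy k).symm.trans_le ht)
    exact (mul_le_mul_of_nonneg_right h6 (hTs k).le).trans hz.le
  · refine ((h5 hc0).and_eventually (eventually_ge_atTop 1)).mono ?_
    rintro k ⟨hAk, hk⟩ t ht htT
    rw [← div_le_iff₀ (hTs k)]
    refine le_psiGen (planeVec l (y k)) ((hT1 k hk).trans_eq (hy k)) ((hy k).symm.trans_le ht)
      fun b z hb1 hbt => ?_
    by_cases hb : (fun i : Fin l => b i.succ.succ) = 0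
    · rw [eq_planeVec hb] at hb1 hbt ⊢
      rw [glue_planeVec, div_le_iff₀ (hTs k)]
      refine (h4 k _ ?_ (hbt.trans_lt htT) z).le
      intro h0
      have h7 : (fun i => (planeVec l 0 i : ℝ)) = 0 := by
        ext i
        rw [show planeVec l 0 = 0 from (eq_planeVec (b := 0) rfl).symm]
        simp
      rw [h0, h7, hN1.map_zero] at hb1
      linarith
    · by_contra hlt
      exact hAk ⟨hA, b, z, hb, hbt.trans htT.le, not_le.1 hlt⟩

end PlaneVec

section RationalIndependence

/-- A nontrivial affine relation between the entries of a matrix holds only on a null set. -/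
lemma volume_affine_relation {m l : ℕ} {a : Fin m → Fin l → ℝ} (ha : a ≠ 0) (h : ℝ) :
    volume {A : Fin m → Fin l → ℝ | h + ∑ j, ∑ i, a j i * A j i = 0} = 0 := by
  let L : (Fin m → Fin l → ℝ) →ₗ[ℝ] ℝ :=
    { toFun := fun A => ∑ j, ∑ i, a j i * A j i
      map_add' := fun x y => by simp [mul_add, Finset.sum_add_distrib]
      map_smul' := fun r x => by simp [Finset.mul_sum, mul_left_comm] }
  let S : AffineSubspace ℝ (Fin m → Fin l → ℝ) :=
    (AffineSubspace.mk' (-h) (⊥ : Submodule ℝ ℝ)).comap L.toAffineMap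
  have hS : ∀ A, A ∈ S ↔ h + ∑ j, ∑ i, a j i * A j i = 0 := by
    intro A
    rw [AffineSubspace.mem_comap, AffineSubspace.mem_mk']
    simp only [LinearMap.coe_toAffineMap, vsub_eq_sub, Submodule.mem_bot, sub_neg_eq_add]
    rw [add_comm]
    rfl
  have hSset : {A : Fin m → Fin l → ℝ | h + ∑ j, ∑ i, a j i * A j i = 0} = S := by
    ext A
    exact (hS A).symm
  rw [hSset]
  refine Measure.addHaar_affineSubspace _ _ fun htop => ha ?_
  have hall : ∀ A : Fin m → Fin l → ℝ, h + ∑ j, ∑ i, a j i * A j i = 0 := fun A => (hS A).1 (htop ▸ trivial)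
  have h0 := hall 0
  have h1 := hall a
  simp only [Pi.zero_apply, mul_zero, Finset.sum_const_zero, add_zero] at h0
  rw [h0, zero_add, Finset.sum_eq_zero_iff_of_nonneg
    fun j _ => Finset.sum_nonneg fun i _ => mul_self_nonneg _] at h1
  ext j i
  have h2 := h1 j (Finset.mem_univ j)
  rw [Finset.sum_eq_zero_iff_of_nonneg fun i _ => mul_self_nonneg _] at h2
  exact mul_self_eq_zero.1 (h2 i (Finset.mem_univ i))

lemma qIndepEntries_glue {m l : ℕ} {β : (Fin m → ℝ) × (Fin m → ℝ)} {A : Fin m → Fin l → ℝ}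
    (hβ : ∀ (h : ℚ) (q : (Fin m → ℚ) × (Fin m → ℚ)),
      (h : ℝ) + ∑ j, (q.1 j * β.1 j + q.2 j * β.2 j) = 0 → q = 0)
    (hA : ∀ (h : ℚ) (q : (Fin m → ℚ) × (Fin m → ℚ)) (a : Fin m → Fin l → ℚ), a ≠ 0 →
      ((h : ℝ) + ∑ j, (q.1 j * β.1 j + q.2 j * β.2 j)) + ∑ j, ∑ i, (a j i : ℝ) * A j i ≠ 0) :
    QIndepEntries m (l + 2) (glue β A) := by
  rw [QIndepEntries, Fintype.linearIndependent_iff]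
  intro g hg
  have hg' : ((g none : ℝ) + ∑ j, ((g (some (j, 0)) : ℝ) * β.1 j + (g (some (j, 1)) : ℝ) * β.2 j)) +
      ∑ j, ∑ i : Fin l, (g (some (j, i.succ.succ)) : ℝ) * A j i = 0 := by
    rw [← hg, Fintype.sum_option, Fintype.sum_prod_type, add_assoc, ← Finset.sum_add_distrib]
    congr 1
    · simp [Rat.smul_def]
    · refine Finset.sum_congr rfl fun j _ => ?_
      have := sum_glue_mul β A j fun i => (g (some (j, i)) : ℝ)
      simp only [Option.elim_some, Rat.smul_def]
      simp only [mul_comm (glue β A j _), mul_comm (A j _)] at this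
      rw [this, add_comm]
  have ha : (fun j (i : Fin l) => g (some (j, i.succ.succ))) = 0 := by
    by_contra hne
    exact hA (g none) (fun j => g (some (j, 0)), fun j => g (some (j, 1))) _ hne hg'
  have ha' : ∀ j (i : Fin l), g (some (j, i.succ.succ)) = 0 := fun j i =>
    congrFun (congrFun ha j) i
  simp only [ha', Rat.cast_zero, zero_mul, Finset.sum_const_zero, add_zero] at hg'
  have hq := hβ (g none) (fun j => g (some (j, 0)), fun j => g (some (j, 1))) hg'
  have h0 : ∀ j, g (some (j, 0)) = 0 := fun j => congrFun (congrArg Prod.fst hq) j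
  have h1 : ∀ j, g (some (j, 1)) = 0 := fun j => congrFun (congrArg Prod.snd hq) j
  simp only [h0, h1, Rat.cast_zero, zero_mul, Finset.sum_const_zero, add_zero,
    Rat.cast_eq_zero] at hg'
  rintro (_ | ⟨j, i⟩)
  · exact hg'
  · refine Fin.cases (h0 j) (fun i => Fin.cases (h1 j) (fun i => ha' j i) i) i

lemma ae_qIndepEntries_glue {m l : ℕ} {β : (Fin m → ℝ) × (Fin m → ℝ)}
    (hβ : ∀ (h : ℚ) (q : (Fin m → ℚ) × (Fin m → ℚ)),
      (h : ℝ) + ∑ j, (q.1 j * β.1 j + q.2 j * β.2 j) = 0 → q = 0) :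
    ∀ᵐ A : Fin m → Fin l → ℝ, QIndepEntries m (l + 2) (glue β A) := by
  have h1 : ∀ᵐ A : Fin m → Fin l → ℝ, ∀ (h : ℚ) (q : (Fin m → ℚ) × (Fin m → ℚ))
      (a : Fin m → Fin l → ℚ), a ≠ 0 →
      ((h : ℝ) + ∑ j, (q.1 j * β.1 j + q.2 j * β.2 j)) + ∑ j, ∑ i, (a j i : ℝ) * A j i ≠ 0 := by
    simp only [ae_all_iff]
    intro h q a ha
    have ha' : (fun j i => (a j i : ℝ)) ≠ 0 := fun h0 => ha <| by
      ext j i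
      have h1 : (a j i : ℝ) = 0 := congrFun (congrFun h0 j) i
      exact_mod_cast h1
    rw [ae_iff]
    simp only [not_not]
    exact volume_affine_relation ha' _
  filter_upwards [h1] with A hA using qIndepEntries_glue hβ hA

end RationalIndependence

section Rank

/-- A corner of a unit box of diagonally dominant matrices. -/
def dominantCorner (m l : ℕ) : Fin m → Fin l → ℝ := fun j i => if (i : ℕ) = j then m + 1 else 0

lemma rank_glue {m l : ℕ} (hml : m ≤ l) (β : (Fin m → ℝ) × (Fin m → ℝ))
    {A : Fin m → Fin l → ℝ} (hA : A ∈ unitBox (dominantCorner m l)) :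
    (Matrix.of (glue β A)).rank = m := by
  set M : Matrix (Fin m) (Fin m) ℝ := fun j i => A j (Fin.castLE hml i) with hM
  have hdet : M.det ≠ 0 := by
    refine det_ne_zero_of_sum_row_lt_diag fun j => ?_
    have hd : (m : ℝ) + 1 ≤ M j j := by
      have := (hA j (Fin.castLE hml j)).1
      simpa [dominantCorner] using this
    have ho : ∀ i ∈ Finset.univ.erase j, ‖M j i‖ ≤ 1 := by
      intro i hi
      have hij : (i : ℕ) ≠ j := fun h => (Finset.ne_of_mem_erase hi) (Fin.ext h)
      have h1 := hA j (Fin.castLE hml i)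
      simp only [dominantCorner, Fin.val_castLE, hij, if_false, zero_add] at h1
      rw [Real.norm_eq_abs, abs_of_nonneg h1.1]
      exact h1.2
    have h2 := Finset.sum_le_card_nsmul _ _ _ ho
    have h3 : ((Finset.univ.erase j).card : ℝ) ≤ m := by
      have := Finset.card_le_univ (Finset.univ.erase j)
      rw [Fintype.card_fin] at this
      exact_mod_cast this
    rw [nsmul_eq_mul, mul_one] at h2
    calc _ ≤ (m : ℝ) := h2.trans h3
      _ < M j j := by linarith
      _ ≤ ‖M j j‖ := Real.le_norm_self _
  have hli : LinearIndependent ℝ (Matrix.of (glue β A)).row := by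
    rw [Fintype.linearIndependent_iff]
    intro g hg
    refine congrFun (Matrix.eq_zero_of_vecMul_eq_zero hdet (v := g) ?_)
    ext i
    have h1 := congrFun hg (Fin.castLE hml i).succ.succ
    simpa [Matrix.vecMul, dotProduct, Finset.sum_apply, glue] using h1
  rw [hli.rank_matrix, Fintype.card_fin]

end Rank

lemma le_dimH_of_volume_ne_zero {m l : ℕ} {G : Set (Fin m → Fin l → ℝ)} (hG : volume G ≠ 0) :
    ((l * m : ℕ) : ℝ≥0∞) ≤ dimH G := by
  have hfin : Module.finrank ℝ (Fin m → Fin l → ℝ) = l * m := by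
    rw [Module.finrank_pi_fintype]
    simp [mul_comm]
  have hac : (volume : Measure (Fin m → Fin l → ℝ)) ≪
      Measure.hausdorffMeasure (Module.finrank ℝ (Fin m → Fin l → ℝ) : ℝ) :=
    Measure.absolutelyContinuous_isAddHaarMeasure _ _
  have h1 := fun h => hG (hac h)
  rw [hfin] at h1
  have h2 := le_dimH_of_hausdorffMeasure_ne_zero (s := G) (d := ((l * m : ℕ) : NNReal))
    (by rwa [NNReal.coe_natCast])
  simpa using h2

lemma dimH_le_of_glue_mem {m l : ℕ} {β : (Fin m → ℝ) × (Fin m → ℝ)}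
    {G : Set (Fin m → Fin l → ℝ)} {S : Set (Fin m → Fin (l + 2) → ℝ)}
    (h : ∀ A ∈ G, glue β A ∈ S) : dimH G ≤ dimH S := by
  let P : (Fin m → Fin (l + 2) → ℝ) → Fin m → Fin l → ℝ := fun Ω j i => Ω j i.succ.succ
  have hP : LipschitzWith 1 P := LipschitzWith.of_dist_le_mul fun x y => by
    rw [NNReal.coe_one, one_mul]
    refine (dist_pi_le_iff dist_nonneg).2 fun j => (dist_pi_le_iff dist_nonneg).2 fun i => ?_
    exact (dist_le_pi_dist (x j) (y j) i.succ.succ).trans (dist_le_pi_dist x y j)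
  have hsub : G ⊆ P '' S := fun A hA => ⟨glue β A, h A hA, rfl⟩
  exact (dimH_mono hsub).trans (hP.dimH_image_le S)

/-- For a suitable choice of the first two columns, a set of positive measure of the remaining
columns gives matrices in `FSsetC` with independent entries. -/
theorem exists_glue_mem_FSsetC {m l : ℕ} (hm : 0 < m) (hr : 2 * m ≤ l + 2)
    {N1 : (Fin (l + 2) → ℝ) → ℝ} {N2 : (Fin m → ℝ) → ℝ} (hN1 : IsNorm N1) (hN2 : IsNorm N2) :
    ∃ cmn : ℝ, 0 < cmn ∧ ∀ c, 0 ≤ c → c ≤ cmn →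
      ∃ (β : (Fin m → ℝ) × (Fin m → ℝ)) (G : Set (Fin m → Fin l → ℝ)), volume G ≠ 0 ∧
        ∀ A ∈ G, glue β A ∈ FSsetC m (l + 2) N1 N2 c ∧ QIndepEntries m (l + 2) (glue β A) ∧
          (m ≤ l → (Matrix.of (glue β A)).rank = m) := by
  have hs : 2 ≤ ((l + 2 : ℕ) : ℝ) / m := by
    rw [le_div_iff₀ (by exact_mod_cast hm)]
    exact_mod_cast hr
  obtain ⟨κ, hν⟩ := exists_isPlaneWeight hN1
  obtain ⟨c₀, hc₀, hpair⟩ := hν.exists_pair hm hN2 hs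
  obtain ⟨c₁, hc₁, hmeas⟩ := exists_volume_eventually_interferenceSet_le hm hN1 hN2
  refine ⟨min c₀ c₁, lt_min hc₀ hc₁, fun c hc hcc => ?_⟩
  obtain ⟨β, y, h1, h2, h3, h4, h5⟩ := hpair c hc (hcc.trans (min_le_left _ _))
  set T : ℕ → ℝ := fun k => N1 fun i => (planeVec l (y k) i : ℝ) with hT
  set lo := dominantCorner m l
  set E : Set (Fin m → Fin l → ℝ) := {A | 0 < c ∧ ∀ᶠ k in atTop,
    A ∈ interferenceSet N1 N2 lo β (T (k + 1)) (c / T (k + 1) ^ (((l + 2 : ℕ) : ℝ) / m))} with hE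
  have hEvol : volume E ≤ 2⁻¹ := by
    rcases hc.eq_or_lt with hc0 | hc0
    · simp [hE, ← hc0]
    · refine (measure_mono fun A hA => hA.2).trans (hmeas c hc0 (hcc.trans (min_le_right _ _)) lo β
        (fun k => T (k + 1)) fun k => ?_)
      have := h1 k
      have : (0 : ℝ) ≤ k := Nat.cast_nonneg k
      linarith
  set Q : Set (Fin m → Fin l → ℝ) := {A | ¬ QIndepEntries m (l + 2) (glue β A)} with hQ
  have hQvol : volume Q = 0 := ae_iff.1 (ae_qIndepEntries_glue h5)
  refine ⟨β, (unitBox lo \ E) \ Q, fun h0 => ?_, ?_⟩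
  · have h6 : (1 : ℝ≥0∞) ≤ 2⁻¹ := by
      calc (1 : ℝ≥0∞) = volume (unitBox lo) := (volume_unitBox lo).symm
        _ ≤ volume ((((unitBox lo \ E) \ Q) ∪ Q) ∪ E) := measure_mono fun A hA => by
          by_cases hAE : A ∈ E
          · exact Or.inr hAE
          · by_cases hAQ : A ∈ Q
            · exact Or.inl (Or.inr hAQ)
            · exact Or.inl (Or.inl ⟨⟨hA, hAE⟩, hAQ⟩)
        _ ≤ volume ((unitBox lo \ E) \ Q) + volume Q + volume E :=
          (measure_union_le _ _).trans (add_le_add (measure_union_le _ _) le_rfl)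
        _ ≤ 2⁻¹ := by rw [h0, hQvol, zero_add, zero_add]; exact hEvol
    exact absurd h6 (not_le.2 (ENNReal.inv_lt_one.2 ENNReal.one_lt_two))
  · rintro A ⟨⟨hA, hAE⟩, hAQ⟩
    have h6 := thetaGen_glue hm hN1 hN2 hc hc₀.le hA (fun k => rfl) h1 h2 h3 h4
      fun hc0 => not_eventually.1 fun hev => hAE ⟨hc0, hev⟩
    exact ⟨⟨h6.1, not_lt.2 h6.2⟩, not_not.1 hAQ, fun hml => rank_glue hml β hA⟩

/-- for `m/n ≤ 1/2`, `n ≠ m + 2` and arbitrary norms, there is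
`c_{m,n} > 0` such that for all `c ∈ [0,c_{m,n}]`: `dim_H FS_{m,n}(‖·‖₁,‖·‖₂,c) ≥ (n−2)m`,
the same bound holds restricted to matrices of full rank `m` with `ℚ`-linearly
independent entries together with `1`, and in particular the Dirichlet spectrum
contains some right neighborhood of `0`. -/
theorem dimH_FSsetC_largeRatio (m n : ℕ) (hm : 0 < m)
    (hr : 2 * m ≤ n) (hne : n ≠ m + 2)
    (N1 : (Fin n → ℝ) → ℝ) (N2 : (Fin m → ℝ) → ℝ)
    (hN1 : IsNorm N1) (hN2 : IsNorm N2) :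
    ∃ cmn : ℝ, 0 < cmn ∧
      (∀ c : ℝ, 0 ≤ c → c ≤ cmn →
        (((n - 2) * m : ℕ) : ℝ≥0∞) ≤ dimH (FSsetC m n N1 N2 c) ∧
        (((n - 2) * m : ℕ) : ℝ≥0∞) ≤ dimH (FSsetC m n N1 N2 c ∩
          {Ω : Fin m → Fin n → ℝ | (Matrix.of Ω).rank = m ∧ QIndepEntries m n Ω})) ∧
      ∃ ε : ℝ, 0 < ε ∧
        Set.Icc (0 : ℝ) ε ⊆ {y : ℝ | ∃ Ω : Fin m → Fin n → ℝ, ThetaGen m n N1 N2 Ω = y} := by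
  obtain ⟨l, rfl⟩ : ∃ l, n = l + 2 := ⟨n - 2, by omega⟩
  obtain ⟨cmn, hcmn, h⟩ := exists_glue_mem_FSsetC hm hr hN1 hN2
  refine ⟨cmn, hcmn, fun c hc hcc => ?_, cmn, hcmn, fun c hc => ?_⟩
  · obtain ⟨β, G, hG, hmem⟩ := h c hc hcc
    have hdim : ((((l + 2) - 2) * m : ℕ) : ℝ≥0∞) ≤ dimH (FSsetC m (l + 2) N1 N2 c ∩
        {Ω : Fin m → Fin (l + 2) → ℝ | (Matrix.of Ω).rank = m ∧ QIndepEntries m (l + 2) Ω}) := by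
      rw [Nat.add_sub_cancel]
      rcases le_or_gt m l with hml | hml
      · exact (le_dimH_of_volume_ne_zero hG).trans (dimH_le_of_glue_mem (β := β) fun A hA =>
          ⟨(hmem A hA).1, (hmem A hA).2.2 hml, (hmem A hA).2.1⟩)
      · obtain rfl : l = 0 := by omega
        simp
    exact ⟨hdim.trans (dimH_mono Set.inter_subset_left), hdim⟩
  · obtain ⟨β, G, hG, hmem⟩ := h c hc.1 hc.2
    obtain ⟨A, hA⟩ := nonempty_of_measure_ne_zero hG
    exact ⟨glue β A, (hmem A hA).1.1⟩
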